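/- arXiv:1901.01591 — 3 statements merged into one kernel-verified Lean document; each statement's English description precedes it below -/
import Mathlib

section
/- For all n ≥ 2 and k ≥ 1, the polynomial W_n^≠(x,t) := Σ_w t^{des(w)} x_w (sum over Smirnov words w of length n over [k] with w_1 ≠ w_n), regarded as a polynomial in t with coefficients symmetric polynomials in x_1,…,x_k, is e-unimodal and palindromic with center of symmetry (n−1)/2. -/
open Finset MvPolynomial Polynomial

attribute [local instance] Classical.propDecidable

noncomputable section

/-- The descent number of a word `w = w₁⋯wₙ` over the alphabet `[k]`:
the number of indices `i ∈ [n-1]` with `wᵢ > wᵢ₊₁`. -/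
def desc {n k : ℕ} (w : Fin n → Fin k) : ℕ :=
  (Finset.univ.filter fun i : Fin n =>
    ∃ h : (i : ℕ) + 1 < n, w ⟨(i : ℕ) + 1, h⟩ < w i).card

/-- The cyclic descent number: the number of indices `i ∈ [n]` with `wᵢ > wᵢ₊₁`,
where `wₙ₊₁ := w₁`. -/
def cdesc {n k : ℕ} (w : Fin n → Fin k) : ℕ :=
  (Finset.univ.filter fun i : Fin n =>
    w ⟨((i : ℕ) + 1) % n, Nat.mod_lt _ i.pos⟩ < w i).card

/-- A word is Smirnov if no two adjacent letters are equal. -/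
def IsSmirnov {n k : ℕ} (w : Fin n → Fin k) : Prop :=
  ∀ i : Fin n, ∀ h : (i : ℕ) + 1 < n, w ⟨(i : ℕ) + 1, h⟩ ≠ w i

/-- the first letter is strictly smaller than the last letter -/
def FirstLtLast {n k : ℕ} (w : Fin n → Fin k) : Prop :=
  ∃ h : 0 < n, w ⟨0, h⟩ < w ⟨n - 1, Nat.sub_lt h Nat.one_pos⟩

/-- the first letter is strictly larger than the last letter -/
def FirstGtLast {n k : ℕ} (w : Fin n → Fin k) : Prop :=
  ∃ h : 0 < n, w ⟨n - 1, Nat.sub_lt h Nat.one_pos⟩ < w ⟨0, h⟩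

/-- the first letter equals the last letter -/
def FirstEqLast {n k : ℕ} (w : Fin n → Fin k) : Prop :=
  ∃ h : 0 < n, w ⟨0, h⟩ = w ⟨n - 1, Nat.sub_lt h Nat.one_pos⟩

/-- the first letter differs from the last letter -/
def FirstNeLast {n k : ℕ} (w : Fin n → Fin k) : Prop :=
  ∃ h : 0 < n, w ⟨0, h⟩ ≠ w ⟨n - 1, Nat.sub_lt h Nat.one_pos⟩

/-- the monomial `x_w = x_{w₁}⋯x_{wₙ}` -/
def xw (R : Type) [CommRing R] {n k : ℕ} (w : Fin n → Fin k) : MvPolynomial (Fin k) R :=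
  ∏ i, MvPolynomial.X (w i)

/-- Generic restricted Smirnov word enumerator: the sum of `t^(stat w) · x_w` over all
Smirnov words `w` of length `n` over `[k]` satisfying `P`, as a polynomial in `t`
with coefficients in `R[x₁,…,x_k]`. -/
def smirnovEnum (R : Type) [CommRing R] (n k : ℕ) (stat : (Fin n → Fin k) → ℕ)
    (P : (Fin n → Fin k) → Prop) : Polynomial (MvPolynomial (Fin k) R) :=
  ∑ w ∈ Finset.univ.filter (fun w : Fin n → Fin k => IsSmirnov w ∧ P w),
    Polynomial.X ^ stat w * Polynomial.C (xw R w)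

/-- e-positivity of a symmetric polynomial in `x₁,…,x_k` (no `t`): it is a nonnegative
combination of products `e_λ = e_{λ₁}⋯e_{λ_ℓ}` over partitions `λ` (multisets of positive
integers). -/
def EPosX (R : Type) [CommRing R] [PartialOrder R] {k : ℕ} (P : MvPolynomial (Fin k) R) : Prop :=
  ∃ (S : Finset (Multiset ℕ)) (c : Multiset ℕ → R),
    (∀ μ ∈ S, ∀ i ∈ μ, 0 < i) ∧ (∀ μ ∈ S, 0 ≤ c μ) ∧
    P = ∑ μ ∈ S, MvPolynomial.C (c μ) * (μ.map (esymm (Fin k) R)).prod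

/-- e-positivity of a polynomial in `t` with coefficients in `R[x₁,…,x_k]`:
`P = Σ_λ c_λ(t) e_λ(x)` over partitions `λ`, where each `c_λ(t)` has nonnegative
coefficients. -/
def EPosT (R : Type) [CommRing R] [PartialOrder R] {k : ℕ}
    (P : Polynomial (MvPolynomial (Fin k) R)) : Prop :=
  ∃ (S : Finset (Multiset ℕ)) (c : Multiset ℕ → Polynomial R),
    (∀ μ ∈ S, ∀ i ∈ μ, 0 < i) ∧ (∀ μ ∈ S, ∀ j, 0 ≤ (c μ).coeff j) ∧
    P = ∑ μ ∈ S, ((c μ).map (MvPolynomial.C : R →+* MvPolynomial (Fin k) R)) *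
          Polynomial.C ((μ.map (esymm (Fin k) R)).prod)

/-- `P`, a polynomial in `t` with coefficients in `R[x₁,…,x_k]`, is symmetric in
`x₁,…,x_k`. -/
def SymmX (R : Type) [CommRing R] {k : ℕ} (P : Polynomial (MvPolynomial (Fin k) R)) : Prop :=
  ∀ j : ℕ, (P.coeff j).IsSymmetric

/-- A polynomial `A = Σ_j a_j t^j` is palindromic with center of symmetry `m/2`:
`a_j = a_{m-j}` for all `j`, where coefficients with index outside `[0,m]` are `0`. -/
def PalinZ {R : Type} [CommRing R] (A : Polynomial R) (m : ℤ) : Prop :=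
  ∀ j : ℕ, A.coeff j = if (j : ℤ) ≤ m then A.coeff (m - (j : ℤ)).toNat else 0

/-- e-unimodality of a polynomial in `t` with coefficients in `R[x₁,…,x_k]`:
`0 ≤_e a_0 ≤_e a_1 ≤_e ⋯ ≤_e a_c ≥_e a_{c+1} ≥_e ⋯ ≥_e 0` for some `c`, where
`f ≤_e g` means `g - f` is e-positive. -/
def EUnimodal (R : Type) [CommRing R] [PartialOrder R] {k : ℕ}
    (A : Polynomial (MvPolynomial (Fin k) R)) : Prop :=
  EPosX R (A.coeff 0) ∧
  ∃ c : ℕ, (∀ j < c, EPosX R (A.coeff (j + 1) - A.coeff j)) ∧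
    (∀ j, c ≤ j → EPosX R (A.coeff j - A.coeff (j + 1)))

namespace SmirnovAux

/-- The transfer matrix with diagonal `c`. -/
def tmat {K : Type} [CommRing K] {k : ℕ} (t : K) (c u : Fin k → K) : Matrix (Fin k) (Fin k) K :=
  Matrix.of fun i j => if i = j then c j else if i < j then -u j else -(t * u j)

lemma tmat_det_one {K : Type} [CommRing K] {k : ℕ} (t : K) (c u : Fin k → K) :
    (tmat t c u + Matrix.replicateCol Unit (fun _ => (1 : K)) * Matrix.replicateRow Unit u).det
      = ∏ j, (c j + u j) := by
  rw [Matrix.det_of_isLowerTriangular]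
  · apply Finset.prod_congr rfl
    intro i _
    simp [tmat, Matrix.mul_apply]
  · intro i j hij
    have hij' : i < j := hij
    simp [tmat, Matrix.mul_apply, hij', hij'.ne]

lemma tmat_det_t {K : Type} [CommRing K] {k : ℕ} (t : K) (c u : Fin k → K) :
    (tmat t c u + Matrix.replicateCol Unit (fun _ => t) * Matrix.replicateRow Unit u).det
      = ∏ j, (c j + t * u j) := by
  rw [Matrix.det_of_isUpperTriangular]
  · apply Finset.prod_congr rfl
    intro i _
    simp [tmat, Matrix.mul_apply]
  · intro i j hij
    have hij' : j < i := hij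
    simp [tmat, Matrix.mul_apply, hij'.not_gt, hij'.ne']

lemma det_rank_one {K : Type} [CommRing K] {k : ℕ} (M P : Matrix (Fin k) (Fin k) K)
    (h : M * P = 1) (u : Fin k → K) (y : K) :
    (M + Matrix.replicateCol Unit (fun _ => y) * Matrix.replicateRow Unit u).det
      = M.det * (1 + y * ∑ a, ∑ b, u a * P a b) := by
  have hu : IsUnit M.det := by
    apply IsUnit.of_mul_eq_one P.det
    rw [← Matrix.det_mul, h, Matrix.det_one]
  rw [Matrix.det_add_replicateCol_mul_replicateRow hu, Matrix.inv_eq_right_inv h]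
  congr 1
  rw [Matrix.det_unique]
  simp only [Matrix.add_apply, Matrix.one_apply_eq, Matrix.mul_apply, Matrix.replicateRow_apply,
    Matrix.replicateCol_apply]
  congr 1
  rw [Finset.mul_sum]
  simp_rw [Finset.sum_mul, Finset.mul_sum]
  rw [Finset.sum_comm]
  refine Finset.sum_congr rfl fun a _ => Finset.sum_congr rfl fun b _ => by ring

lemma det_total {K : Type} [CommRing K] {k : ℕ} (t : K) (c u : Fin k → K)
    (P : Matrix (Fin k) (Fin k) K) (h : tmat t c u * P = 1) :
    (tmat t c u).det * (1 + ∑ a, ∑ b, u a * P a b) = ∏ j, (c j + u j) := by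
  rw [← tmat_det_one t, det_rank_one _ P h, one_mul]

lemma det_formula {K : Type} [CommRing K] {k : ℕ} (t : K) (c u : Fin k → K)
    (P : Matrix (Fin k) (Fin k) K) (h : tmat t c u * P = 1) :
    (1 - t) * (tmat t c u).det = ∏ j, (c j + t * u j) - t * ∏ j, (c j + u j) := by
  rw [← tmat_det_t t c u, ← tmat_det_one t c u, det_rank_one _ P h, det_rank_one _ P h]
  ring

lemma det_eps {K : Type} [CommRing K] {k : ℕ} (t e : K) (he : e * e = 0) (u : Fin k → K)
    (P : Matrix (Fin k) (Fin k) K) (h : tmat t (fun _ => 1) u * P = 1) :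
    (1 - t) * ((tmat t (fun _ => 1) u).det * (1 - e * ∑ a, u a * P a a))
      = ∏ j, (1 + (t - e) * u j) - t * ∏ j, (1 + (1 - e) * u j) := by
  set M := tmat t (fun _ => 1) u with hM
  set V := P * Matrix.diagonal u with hV
  have hMe : tmat t (fun j => 1 - e * u j) u = M * (1 + (-e) • V) := by
    rw [mul_add, mul_one, Matrix.mul_smul, hV, ← mul_assoc, h, one_mul]
    ext i j
    by_cases hij : i = j
    · subst hij; simp [hM, tmat]; ring
    · simp [hM, tmat, hij]
  have hdet : (1 + (-e) • V).det = 1 - e * ∑ a, u a * P a a := by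
    rw [Matrix.det_one_add_smul]
    have : (-e) ^ 2 = 0 := by rw [neg_sq, pow_two, he]
    rw [this]
    have htr : V.trace = ∑ a, u a * P a a := by
      simp only [Matrix.trace, hV, Matrix.diag_apply, Matrix.mul_diagonal]
      exact Finset.sum_congr rfl fun a _ => mul_comm _ _
    rw [htr]
    ring
  have hinv : (1 + (-e) • V) * (1 + e • V) = 1 := by
    simp [mul_add, add_mul, smul_smul, he]
  have hP' : tmat t (fun j => 1 - e * u j) u * ((1 + e • V) * P) = 1 := by
    rw [hMe, mul_assoc, ← mul_assoc (1 + (-e) • V), hinv, one_mul, h]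
  have := det_formula t _ u _ hP'
  rw [hMe, Matrix.det_mul, hdet] at this
  rw [this]
  congr 1
  · exact Finset.prod_congr rfl fun a _ => by ring
  · congr 1
    exact Finset.prod_congr rfl fun a _ => by ring

lemma prod_expand {K : Type} [CommRing K] {k : ℕ} (φ : MvPolynomial (Fin k) ℤ →+* K) (c z : K) :
    ∏ j : Fin k, (1 + c * (z * φ (MvPolynomial.X j)))
      = ∑ i ∈ Finset.range (k + 1), c ^ i * (z ^ i * φ (esymm (Fin k) ℤ i)) := by
  rw [Finset.prod_one_add, Finset.sum_powerset]
  simp only [Finset.card_univ, Fintype.card_fin]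
  refine Finset.sum_congr rfl fun i _ => ?_
  rw [esymm, map_sum, Finset.mul_sum, Finset.mul_sum]
  refine Finset.sum_congr rfl fun s hs => ?_
  rw [Finset.mem_powersetCard] at hs
  rw [Finset.prod_mul_distrib, Finset.prod_mul_distrib, Finset.prod_const, Finset.prod_const, hs.2,
    map_prod]

lemma pow_sub_eps {K : Type} [CommRing K] (a e : K) (he : e * e = 0) (i : ℕ) :
    (a - e) ^ i = a ^ i - i * a ^ (i - 1) * e := by
  induction i with
  | zero => simp
  | succ i ih =>
    rw [pow_succ, ih]
    rcases i with _ | i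
    · simp
    · simp only [Nat.add_sub_cancel]
      push_cast
      linear_combination ((i : K) + 1) * a ^ i * he

open DualNumber in
lemma trace_formula {S : Type} [CommRing S] {k : ℕ} (φ : MvPolynomial (Fin k) ℤ →+* S) (t z : S)
    (P : Matrix (Fin k) (Fin k) S)
    (h : tmat t (fun _ => 1) (fun j => z * φ (MvPolynomial.X j)) * P = 1) :
    (1 - t) * ((tmat t (fun _ => 1) (fun j => z * φ (MvPolynomial.X j))).det *
      ∑ a, (z * φ (MvPolynomial.X a)) * P a a)
    = ∑ i ∈ Finset.range (k + 1), (i * (t ^ (i - 1) - t)) * (z ^ i * φ (esymm (Fin k) ℤ i)) := by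
  let ι : S →+* DualNumber S := TrivSqZeroExt.inlHom S S
  have hε : (ε : DualNumber S) * ε = 0 := DualNumber.eps_mul_eps
  have hmap : tmat (ι t) (fun _ => 1) (fun j => ι z * (ι.comp φ) (MvPolynomial.X j))
      = ι.mapMatrix (tmat t (fun _ => 1) (fun j => z * φ (MvPolynomial.X j))) := by
    ext i j : 1
    simp only [tmat, RingHom.mapMatrix_apply, Matrix.map_apply, Matrix.of_apply]
    split_ifs <;> simp
  have h' : tmat (ι t) (fun _ => 1) (fun j => ι z * (ι.comp φ) (MvPolynomial.X j))
      * ι.mapMatrix P = 1 := by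
    rw [hmap, ← map_mul, h, map_one]
  have key := det_eps (ι t) ε hε _ _ h'
  rw [prod_expand, prod_expand, hmap, ← RingHom.map_det] at key
  simp_rw [pow_sub_eps _ _ hε] at key
  have key2 := congrArg TrivSqZeroExt.snd key
  rw [← neg_inj]
  set D := (tmat t (fun _ => 1) (fun j => z * φ (MvPolynomial.X j))).det
  have hl : (1 - ι t) * (ι D * (1 - ε * ∑ a, ι z * (ι.comp φ) (MvPolynomial.X a)
      * ι.mapMatrix P a a)) = ι ((1 - t) * D)
        + ε * ι (-((1 - t) * (D * ∑ a, z * φ (MvPolynomial.X a) * P a a))) := by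
    simp only [map_mul, map_sub, map_one, map_neg, map_sum, RingHom.comp_apply,
      RingHom.mapMatrix_apply, Matrix.map_apply]
    ring
  have hr : ∑ i ∈ Finset.range (k + 1), (ι t ^ i - (i : DualNumber S) * ι t ^ (i - 1) * ε)
        * (ι z ^ i * (ι.comp φ) (esymm (Fin k) ℤ i))
      - ι t * ∑ i ∈ Finset.range (k + 1), (1 ^ i - (i : DualNumber S) * 1 ^ (i - 1) * ε)
        * (ι z ^ i * (ι.comp φ) (esymm (Fin k) ℤ i))
      = ι (∑ i ∈ Finset.range (k + 1), (t ^ i - t) * (z ^ i * φ (esymm (Fin k) ℤ i)))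
        + ε * ι (-∑ i ∈ Finset.range (k + 1),
          (i * (t ^ (i - 1) - t)) * (z ^ i * φ (esymm (Fin k) ℤ i))) := by
    simp only [map_mul, map_sub, map_pow, map_neg, map_sum, RingHom.comp_apply, map_natCast]
    rw [← Finset.sum_neg_distrib, Finset.mul_sum, Finset.mul_sum, ← Finset.sum_add_distrib,
      ← Finset.sum_sub_distrib]
    refine Finset.sum_congr rfl fun i _ => ?_
    ring
  have hsnd : ∀ x y : S, TrivSqZeroExt.snd (ι x + ε * ι y) = y := by
    intro x y
    simp [ι]
  rwa [hl, hr, hsnd, hsnd] at key2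

/-- Products of elementary symmetric polynomials with positive indices. -/
def eGen (k : ℕ) : Set (MvPolynomial (Fin k) ℤ) :=
  {p | ∃ μ : Multiset ℕ, (∀ i ∈ μ, 0 < i) ∧ p = (μ.map (esymm (Fin k) ℤ)).prod}

lemma eGen_one (k : ℕ) : (1 : MvPolynomial (Fin k) ℤ) ∈ eGen k := ⟨0, by simp, by simp⟩

lemma eGen_esymm (k i : ℕ) (hi : 0 < i) : esymm (Fin k) ℤ i ∈ eGen k :=
  ⟨{i}, by simpa using hi, by simp⟩

lemma eGen_mul {k : ℕ} {p q : MvPolynomial (Fin k) ℤ} (hp : p ∈ eGen k) (hq : q ∈ eGen k) :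
    p * q ∈ eGen k := by
  obtain ⟨μ, h1, rfl⟩ := hp
  obtain ⟨ν, h2, rfl⟩ := hq
  refine ⟨μ + ν, ?_, by simp⟩
  intro i hi
  rcases Multiset.mem_add.1 hi with h | h
  · exact h1 i h
  · exact h2 i h

lemma ePosX_zero {k : ℕ} : EPosX ℤ (0 : MvPolynomial (Fin k) ℤ) :=
  ⟨∅, 0, by simp, by simp, by simp⟩

lemma ePosX_gen {k : ℕ} {p : MvPolynomial (Fin k) ℤ} (hp : p ∈ eGen k) : EPosX ℤ p := by
  obtain ⟨μ, h, rfl⟩ := hp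
  exact ⟨{μ}, fun _ => 1, by simpa using h, by simp, by simp⟩

lemma ePosX_add {k : ℕ} {p q : MvPolynomial (Fin k) ℤ} (hp : EPosX ℤ p) (hq : EPosX ℤ q) :
    EPosX ℤ (p + q) := by
  obtain ⟨S, c, hS, hc, rfl⟩ := hp
  obtain ⟨T, d, hT, hd, rfl⟩ := hq
  refine ⟨S ∪ T, fun μ => (if μ ∈ S then c μ else 0) + (if μ ∈ T then d μ else 0), ?_, ?_, ?_⟩
  · intro μ hμ
    rcases Finset.mem_union.1 hμ with h | h
    · exact hS μ h
    · exact hT μ h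
  · intro μ _
    apply add_nonneg
    · split_ifs with h
      · exact hc μ h
      · exact le_rfl
    · split_ifs with h
      · exact hd μ h
      · exact le_rfl
  · simp only [map_add, add_mul, Finset.sum_add_distrib]
    congr 1
    · rw [← Finset.sum_subset (Finset.subset_union_left (s₁ := S) (s₂ := T))]
      · exact Finset.sum_congr rfl fun μ h => by simp [h]
      · intro μ _ h; simp [h]
    · rw [← Finset.sum_subset (Finset.subset_union_right (s₁ := S) (s₂ := T))]
      · exact Finset.sum_congr rfl fun μ h => by simp [h]
      · intro μ _ h; simp [h]

/-- `[b]_t`. -/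
def qn (k b : ℕ) : Polynomial (MvPolynomial (Fin k) ℤ) :=
  ∑ i ∈ Finset.range b, Polynomial.X ^ i

/-- Generators `t^a [b]_t e_λ` with `2a + b = m + 1`. -/
def coneGen (k m : ℕ) : Set (Polynomial (MvPolynomial (Fin k) ℤ)) :=
  {A | ∃ a b p, 2 * a + b = m + 1 ∧ p ∈ eGen k ∧ A = Polynomial.X ^ a * qn k b * Polynomial.C p}

/-- The cone of palindromic e-unimodal polynomials of center `m/2`. -/
def cone (k m : ℕ) : AddSubmonoid (Polynomial (MvPolynomial (Fin k) ℤ)) :=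
  AddSubmonoid.closure (coneGen k m)

lemma cone_gen {k m a b : ℕ} {p : MvPolynomial (Fin k) ℤ} (h : 2 * a + b = m + 1)
    (hp : p ∈ eGen k) : Polynomial.X ^ a * qn k b * Polynomial.C p ∈ cone k m :=
  AddSubmonoid.subset_closure ⟨a, b, p, h, hp, rfl⟩

lemma qn_mul (k b c : ℕ) :
    qn k (b + 1) * qn k (c + 1) = qn k (b + c + 1) + Polynomial.X * (qn k b * qn k c) := by
  have h1 : qn k (b + 1) = Polynomial.X * qn k b + 1 := by
    simp [qn, Finset.sum_range_succ', Finset.mul_sum, pow_succ']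
  have h2 : qn k (c + 1) = qn k c + Polynomial.X ^ c := by
    simp [qn, Finset.sum_range_succ]
  have h3 : qn k (b + c + 1) = qn k c + Polynomial.X ^ c * qn k (b + 1) := by
    rw [show b + c + 1 = c + (b + 1) by ring]
    simp only [qn]
    rw [Finset.sum_range_add, Finset.mul_sum]
    simp [pow_add]
  rw [h3, h2, h1]
  ring

lemma cone_mul_gen {k : ℕ} (b : ℕ) : ∀ (c a m : ℕ) (p : MvPolynomial (Fin k) ℤ), p ∈ eGen k →
    2 * a + b + c = m + 2 →
    Polynomial.X ^ a * (qn k b * qn k c) * Polynomial.C p ∈ cone k m := by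
  induction b with
  | zero =>
    intro c a m p _ _
    have : qn k 0 = 0 := by simp [qn]
    rw [this]; simp
  | succ b ih =>
    intro c a m p hp h
    rcases c with _ | c
    · have : qn k 0 = 0 := by simp [qn]
      rw [this]; simp
    · rw [qn_mul, mul_add, add_mul]
      refine add_mem (cone_gen (by omega) hp) ?_
      have := ih c (a + 1) m p hp (by omega)
      rwa [pow_succ, mul_assoc (Polynomial.X ^ a)] at this

lemma cone_mul {k m l : ℕ} {A B : Polynomial (MvPolynomial (Fin k) ℤ)} (hA : A ∈ cone k m)
    (hB : B ∈ cone k l) : A * B ∈ cone k (m + l) := by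
  induction hA using AddSubmonoid.closure_induction with
  | zero => simp
  | add x y _ _ h1 h2 => rw [add_mul]; exact add_mem h1 h2
  | mem x hx =>
    obtain ⟨a, b, p, h, hp, rfl⟩ := hx
    induction hB using AddSubmonoid.closure_induction with
    | zero => simp
    | add x y _ _ h1 h2 => rw [mul_add]; exact add_mem h1 h2
    | mem y hy =>
      obtain ⟨a', b', p', h', hp', rfl⟩ := hy
      have := cone_mul_gen b b' (a + a') (m + l) _ (eGen_mul hp hp') (by omega)
      convert this using 1
      rw [map_mul]; ring

lemma coeff_gen (k a b j : ℕ) (p : MvPolynomial (Fin k) ℤ) :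
    (Polynomial.X ^ a * qn k b * Polynomial.C p).coeff j
      = if a ≤ j ∧ j < a + b then p else 0 := by
  rw [Polynomial.coeff_mul_C, mul_comm, mul_comm (Polynomial.X ^ a), Polynomial.coeff_mul_X_pow']
  simp only [qn, Polynomial.finsetSum_coeff, Polynomial.coeff_X_pow]
  by_cases h : a ≤ j
  · by_cases h2 : j < a + b
    · simp [h, h2]; intro; omega
    · simp [h, h2]; intro; omega
  · simp [h]

lemma cone_prop {k m : ℕ} {A : Polynomial (MvPolynomial (Fin k) ℤ)} (hA : A ∈ cone k m) :
    EUnimodal ℤ A ∧ PalinZ A (m : ℤ) := by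
  suffices h : EPosX ℤ (A.coeff 0) ∧ (∀ j < m / 2, EPosX ℤ (A.coeff (j + 1) - A.coeff j)) ∧
      (∀ j, m / 2 ≤ j → EPosX ℤ (A.coeff j - A.coeff (j + 1))) ∧ PalinZ A (m : ℤ) from
    ⟨⟨h.1, m / 2, h.2.1, h.2.2.1⟩, h.2.2.2⟩
  induction hA using AddSubmonoid.closure_induction with
  | zero => simp [ePosX_zero, PalinZ]
  | add x y _ _ hx hy =>
    refine ⟨?_, ?_, ?_, ?_⟩
    · rw [Polynomial.coeff_add]; exact ePosX_add hx.1 hy.1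
    · intro j hj
      rw [Polynomial.coeff_add, Polynomial.coeff_add, add_sub_add_comm]
      exact ePosX_add (hx.2.1 j hj) (hy.2.1 j hj)
    · intro j hj
      rw [Polynomial.coeff_add, Polynomial.coeff_add, add_sub_add_comm]
      exact ePosX_add (hx.2.2.1 j hj) (hy.2.2.1 j hj)
    · intro j
      have h1 := hx.2.2.2 j
      have h2 := hy.2.2.2 j
      rw [Polynomial.coeff_add, Polynomial.coeff_add, h1, h2]
      split_ifs <;> simp
  | mem x hx =>
    obtain ⟨a, b, p, h, hp, rfl⟩ := hx
    have hpp := ePosX_gen hp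
    refine ⟨?_, ?_, ?_, ?_⟩
    · rw [coeff_gen]
      split_ifs
      · exact hpp
      · exact ePosX_zero
    · intro j hj
      rw [coeff_gen, coeff_gen]
      split_ifs
      · rw [sub_self]; exact ePosX_zero
      · rw [sub_zero]; exact hpp
      · omega
      · rw [sub_self]; exact ePosX_zero
    · intro j hj
      rw [coeff_gen, coeff_gen]
      split_ifs
      · rw [sub_self]; exact ePosX_zero
      · rw [sub_zero]; exact hpp
      · omega
      · rw [sub_self]; exact ePosX_zero
    · intro j
      rw [coeff_gen, coeff_gen]
      split_ifs <;> first | rfl | omega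

/-- The ring of coefficients. -/
abbrev RR (k : ℕ) := Polynomial (MvPolynomial (Fin k) ℤ)

/-- Step weights. -/
def bmat (k : ℕ) : Matrix (Fin k) (Fin k) (RR k) :=
  Matrix.of fun i j =>
    if i = j then 0 else if i < j then Polynomial.C (MvPolynomial.X j)
      else Polynomial.X * Polynomial.C (MvPolynomial.X j)

lemma sum_walks {K : Type} [CommRing K] {k : ℕ} (B : Matrix (Fin k) (Fin k) K) (n : ℕ) :
    ∀ g : Fin k → Fin k → K,
    ∑ w : Fin (n + 1) → Fin k, g (w 0) (w (Fin.last n)) * ∏ i : Fin n, B (w i.castSucc) (w i.succ)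
      = ∑ a, ∑ b, g a b * (B ^ n) a b := by
  induction n with
  | zero =>
    intro g
    rw [← (Equiv.funUnique (Fin 1) (Fin k)).symm.sum_comp]
    simp [Matrix.one_apply, Fin.last]
  | succ n ih =>
    intro g
    rw [← (Fin.consEquiv (fun _ => Fin k)).sum_comp, Fintype.sum_prod_type]
    refine Finset.sum_congr rfl fun a _ => ?_
    have := ih (fun c b => g a b * B a c)
    calc _ = ∑ w : Fin (n + 1) → Fin k, (g a (w (Fin.last n)) * B a (w 0)) *
              ∏ i : Fin n, B (w i.castSucc) (w i.succ) := by
            refine Finset.sum_congr rfl fun w _ => ?_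
            rw [Fin.prod_univ_succ]
            simp only [Fin.consEquiv_apply, Fin.cons_zero, Fin.castSucc_zero, Fin.cons_succ,
              ← Fin.succ_last, Fin.castSucc_succ, mul_assoc]
      _ = _ := by
            rw [this, Finset.sum_comm]
            refine Finset.sum_congr rfl fun b _ => ?_
            rw [pow_succ', Matrix.mul_apply, Finset.mul_sum]
            exact Finset.sum_congr rfl fun c _ => by ring

lemma word_weight {n k : ℕ} (w : Fin (n + 1) → Fin k) :
    Polynomial.C (MvPolynomial.X (w 0)) * ∏ i : Fin n, bmat k (w i.castSucc) (w i.succ)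
      = if IsSmirnov w then Polynomial.X ^ desc w * Polynomial.C (xw ℤ w) else 0 := by
  split_ifs with h
  · have hb : ∀ i : Fin n, bmat k (w i.castSucc) (w i.succ)
        = (if w i.succ < w i.castSucc then Polynomial.X else 1)
          * Polynomial.C (MvPolynomial.X (w i.succ)) := by
      intro i
      have hne : w i.succ ≠ w i.castSucc := h i.castSucc (by simp)
      rcases lt_or_gt_of_ne hne with h1 | h1
      · simp [bmat, hne.symm, h1, h1.not_gt]
      · simp [bmat, hne.symm, h1, h1.not_gt]
    have hd : desc w = (Finset.univ.filter fun i : Fin n => w i.succ < w i.castSucc).card := by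
      unfold desc
      symm
      apply Finset.card_bij (fun i _ => i.castSucc)
      · intro i hi
        rw [Finset.mem_filter] at hi ⊢
        exact ⟨Finset.mem_univ _, by simp, hi.2⟩
      · intro i _ j _ hij
        exact Fin.castSucc_injective _ hij
      · intro i hi
        rw [Finset.mem_filter] at hi
        obtain ⟨_, hlt, h2⟩ := hi
        refine ⟨⟨i, by omega⟩, ?_, rfl⟩
        rw [Finset.mem_filter]
        exact ⟨Finset.mem_univ _, h2⟩
    rw [Finset.prod_congr rfl fun i _ => hb i, Finset.prod_mul_distrib, Finset.prod_ite, hd,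
      xw, Fin.prod_univ_succ]
    simp only [Finset.prod_const, map_mul, map_prod]
    ring
  · unfold IsSmirnov at h
    push Not at h
    obtain ⟨i, hi, h2⟩ := h
    have : bmat k (w (Fin.castSucc ⟨i, by omega⟩)) (w (Fin.succ ⟨i, by omega⟩)) = (0 : RR k) := by
      have h3 : w (Fin.castSucc ⟨i, by omega⟩) = w (Fin.succ ⟨i, by omega⟩) := h2.symm
      rw [h3]
      simp [bmat]
    rw [Finset.prod_eq_zero (Finset.mem_univ (⟨i, by omega⟩ : Fin n)) this, mul_zero]

lemma enum_eq (n k : ℕ) : smirnovEnum ℤ (n + 1) k desc FirstNeLast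
    = ∑ a, ∑ b, (if a = b then 0 else Polynomial.C (MvPolynomial.X a)) * (bmat k ^ n) a b := by
  rw [← sum_walks, smirnovEnum, Finset.sum_filter]
  refine Finset.sum_congr rfl fun w _ => ?_
  have hw := word_weight w
  have hne : FirstNeLast w ↔ ¬ (w 0 = w (Fin.last n)) :=
    ⟨fun ⟨_, h⟩ => h, fun h => ⟨by omega, h⟩⟩
  by_cases h0 : w 0 = w (Fin.last n)
  · rw [if_neg (fun h => hne.1 h.2 h0), if_pos h0, zero_mul]
  · rw [if_neg h0, hw]
    by_cases hs : IsSmirnov w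
    · rw [if_pos hs, if_pos ⟨hs, hne.2 h0⟩]
    · rw [if_neg hs, if_neg (fun h => hs h.1)]

/-- Embedding of the symmetric coefficients into power series. -/
def phi (k : ℕ) : MvPolynomial (Fin k) ℤ →+* PowerSeries (RR k) :=
  (PowerSeries.C (R := RR k)).comp Polynomial.C

/-- The variable `t` as a power series in `z`. -/
def tt (k : ℕ) : PowerSeries (RR k) := PowerSeries.C (R := RR k) Polynomial.X

/-- The matrix of walk generating functions. -/
def pmat (k : ℕ) : Matrix (Fin k) (Fin k) (PowerSeries (RR k)) :=
  Matrix.of fun a b => PowerSeries.mk fun n => (bmat k ^ n) a b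

lemma tmat_pmat (k : ℕ) :
    tmat (tt k) (fun _ => 1) (fun j => PowerSeries.X * phi k (MvPolynomial.X j)) * pmat k = 1 := by
  have h1 : tmat (tt k) (fun _ => 1) (fun j => PowerSeries.X * phi k (MvPolynomial.X j))
      = 1 - (PowerSeries.X : PowerSeries (RR k)) • (bmat k).map (PowerSeries.C (R := RR k)) := by
    ext1 i j
    by_cases hij : i = j
    · subst hij; simp [tmat, bmat]
    · by_cases hl : i < j
      · simp [tmat, bmat, hij, hl, phi]
      · simp [tmat, bmat, hij, hl, phi, tt]; ring
  rw [h1, sub_mul, one_mul, Matrix.smul_mul]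
  ext i j n
  simp only [Matrix.sub_apply, Matrix.smul_apply, Matrix.mul_apply, smul_eq_mul, map_sub]
  rcases n with _ | n
  · by_cases hij : i = j
    · subst hij; simp [pmat]
    · simp [pmat, hij]
  · rw [PowerSeries.coeff_succ_X_mul]
    have : PowerSeries.coeff (n + 1) ((1 : Matrix (Fin k) (Fin k) (PowerSeries (RR k))) i j) = 0 := by
      by_cases hij : i = j
      · subst hij; simp [PowerSeries.coeff_one]
      · simp [hij]
    rw [this]
    simp only [pmat, Matrix.of_apply, PowerSeries.coeff_mk, map_sum, Matrix.map_apply,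
      PowerSeries.coeff_C_mul]
    rw [pow_succ', Matrix.mul_apply, sub_self]

lemma esymm_big (k n : ℕ) (h : k < n) : esymm (Fin k) ℤ n = 0 := by
  rw [esymm, Finset.powersetCard_eq_empty.2 (by simpa using h), Finset.sum_empty]

lemma coeff_esum (k n : ℕ) (f : ℕ → RR k) :
    PowerSeries.coeff n (∑ i ∈ Finset.range (k + 1),
      PowerSeries.C (R := RR k) (f i) * (PowerSeries.X ^ i * phi k (esymm (Fin k) ℤ i)))
    = f n * Polynomial.C (esymm (Fin k) ℤ n) := by
  have h : ∀ i, PowerSeries.coeff n (PowerSeries.C (R := RR k) (f i) *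
      (PowerSeries.X ^ i * phi k (esymm (Fin k) ℤ i)))
      = if n = i then f i * Polynomial.C (esymm (Fin k) ℤ i) else 0 := by
    intro i
    simp only [phi, RingHom.comp_apply]
    rw [PowerSeries.coeff_C_mul, PowerSeries.coeff_mul_C, PowerSeries.coeff_X_pow]
    split_ifs <;> simp
  rw [map_sum, Finset.sum_congr rfl fun i _ => h i, Finset.sum_ite_eq]
  split_ifs with hn
  · rfl
  · rw [esymm_big k n (by simpa using hn)]; simp

/-- The generating function. -/
def gf (k : ℕ) : PowerSeries (RR k) :=
  PowerSeries.mk fun n => match n with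
    | 0 => 0
    | n + 1 => smirnovEnum ℤ (n + 1) k desc FirstNeLast

lemma offdiag {K : Type} [CommRing K] {k : ℕ} (z : K) (u : Fin k → K)
    (P : Matrix (Fin k) (Fin k) K) :
    ∑ a, ∑ b, (z * u a) * P a b - ∑ a, (z * u a) * P a a
      = z * ∑ a, ∑ b, (if a = b then 0 else u a) * P a b := by
  rw [Finset.mul_sum, ← Finset.sum_sub_distrib]
  refine Finset.sum_congr rfl fun a _ => ?_
  have h : ∀ b, (if a = b then 0 else u a) * P a b
      = u a * P a b - (if a = b then u a * P a b else 0) := by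
    intro b
    split_ifs <;> simp
  rw [Finset.sum_congr rfl fun b _ => h b, Finset.sum_sub_distrib, Finset.sum_ite_eq,
    if_pos (Finset.mem_univ a), mul_sub, Finset.mul_sum, mul_assoc]
  congr 1
  exact Finset.sum_congr rfl fun b _ => mul_assoc _ _ _

lemma gf_eq (k : ℕ) : gf k =
    ∑ a, ∑ b, (PowerSeries.X * phi k (MvPolynomial.X a)) * pmat k a b
      - ∑ a, (PowerSeries.X * phi k (MvPolynomial.X a)) * pmat k a a := by
  rw [offdiag]
  ext1 n
  rcases n with _ | n
  · simp [gf]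
  · have hg : PowerSeries.coeff (n + 1) (gf k) = smirnovEnum ℤ (n + 1) k desc FirstNeLast := by
      rw [gf, PowerSeries.coeff_mk]
    rw [PowerSeries.coeff_succ_X_mul, hg, enum_eq]
    simp only [map_sum]
    refine Finset.sum_congr rfl fun a _ => Finset.sum_congr rfl fun b _ => ?_
    split_ifs
    · simp
    · simp only [phi, RingHom.comp_apply, PowerSeries.coeff_C_mul, pmat, Matrix.of_apply,
        PowerSeries.coeff_mk]

lemma gf_identity (k : ℕ) :
    (∑ i ∈ Finset.range (k + 1), PowerSeries.C (R := RR k) (Polynomial.X ^ i - Polynomial.X)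
      * (PowerSeries.X ^ i * phi k (esymm (Fin k) ℤ i))) * gf k
    = ∑ i ∈ Finset.range (k + 1), PowerSeries.C (R := RR k)
        (1 - Polynomial.X ^ i - (i : RR k) * (Polynomial.X ^ (i - 1) - Polynomial.X))
      * (PowerSeries.X ^ i * phi k (esymm (Fin k) ℤ i)) := by
  have h1 := det_total _ _ _ _ (tmat_pmat k)
  have h2 := det_formula _ _ _ _ (tmat_pmat k)
  have h3 := trace_formula (phi k) _ _ _ (tmat_pmat k)
  have e1 := prod_expand (phi k) 1 PowerSeries.X
  have e2 := prod_expand (phi k) (tt k) PowerSeries.X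
  simp only [one_mul, one_pow] at e1
  rw [e1] at h1 h2
  rw [e2] at h2
  rw [gf_eq]
  set D := (tmat (tt k) (fun _ => 1) (fun j => PowerSeries.X * phi k (MvPolynomial.X j))).det
  set T := ∑ a, ∑ b, (PowerSeries.X * phi k (MvPolynomial.X a)) * pmat k a b
  set τ := ∑ a, (PowerSeries.X * phi k (MvPolynomial.X a)) * pmat k a a
  have htt : PowerSeries.C (R := RR k) Polynomial.X = tt k := rfl
  simp only [map_sub, map_pow, map_mul, map_one, map_natCast, htt]
  simp only [sub_mul _ _ (_ * _), Finset.sum_sub_distrib, one_mul]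
  rw [← Finset.mul_sum]
  linear_combination (-(T - τ)) * h2 + (1 - tt k) * h1 - h2 - h3

lemma qn_spec (k b : ℕ) : (1 - Polynomial.X) * qn k b = 1 - Polynomial.X ^ b := by
  rw [qn, mul_neg_geom_sum]

/-- The numerator polynomial. -/
def num (k : ℕ) : ℕ → RR k
  | 0 => 0
  | n + 1 => qn k (n + 2) + (n + 2) • (Polynomial.X * qn k n)

lemma num_spec (k n : ℕ) : (1 - Polynomial.X) * num k n
    = 1 - Polynomial.X ^ (n + 1)
      - ((n + 1 : ℕ) : RR k) * (Polynomial.X ^ n - Polynomial.X) := by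
  rcases n with _ | n
  · simp [num]
  · rw [num, mul_add, qn_spec, nsmul_eq_mul]
    have := qn_spec k n
    push_cast
    linear_combination ((n : RR k) + 2) * Polynomial.X * this

lemma recurrence (n k : ℕ) :
    (PowerSeries.coeff (n + 1) (gf k) : RR k)
      = num k n * Polynomial.C (esymm (Fin k) ℤ (n + 1)) +
        ∑ p ∈ Finset.HasAntidiagonal.antidiagonal n, (Polynomial.X ^ 1 * qn k p.1 *
          Polynomial.C (esymm (Fin k) ℤ (p.1 + 1))) * PowerSeries.coeff p.2 (gf k) := by
  have h := congrArg (PowerSeries.coeff (n + 1)) (gf_identity k)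
  rw [PowerSeries.coeff_mul, coeff_esum] at h
  simp only [coeff_esum] at h
  rw [Finset.Nat.sum_antidiagonal_succ] at h
  simp only [pow_zero, esymm_zero, map_one, mul_one, Nat.add_sub_cancel] at h
  rw [← num_spec] at h
  have h1 : (1 - Polynomial.X : RR k) ≠ 0 := by
    intro h0
    have := congrArg (fun p : RR k => p.coeff 0) h0
    simp at this
  apply mul_left_cancel₀ h1
  have h2 : (1 - Polynomial.X : RR k) * ∑ p ∈ Finset.HasAntidiagonal.antidiagonal n, (Polynomial.X ^ 1 * qn k p.1 *
          Polynomial.C (esymm (Fin k) ℤ (p.1 + 1))) * PowerSeries.coeff p.2 (gf k)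
      = - ∑ p ∈ Finset.HasAntidiagonal.antidiagonal n, (Polynomial.X ^ (p.1 + 1) - Polynomial.X) *
          Polynomial.C (esymm (Fin k) ℤ (p.1 + 1)) * PowerSeries.coeff p.2 (gf k) := by
    rw [Finset.mul_sum, ← Finset.sum_neg_distrib]
    refine Finset.sum_congr rfl fun p _ => ?_
    have := qn_spec k p.1
    linear_combination (Polynomial.X *
          Polynomial.C (esymm (Fin k) ℤ (p.1 + 1)) * PowerSeries.coeff p.2 (gf k)) * this
  rw [mul_add, h2]
  linear_combination h

lemma gf_mem_cone (k n : ℕ) : PowerSeries.coeff (n + 1) (gf k) ∈ cone k n := by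
  induction n using Nat.strong_induction_on with
  | _ n ih =>
    rw [recurrence]
    refine add_mem ?_ (sum_mem ?_)
    · rcases n with _ | n
      · simp [num]
      · rw [num, add_mul, smul_mul_assoc]
        have he := eGen_esymm k (n + 1 + 1) (by omega)
        refine add_mem ?_ (nsmul_mem ?_ _)
        · simpa using cone_gen (m := n + 1) (a := 0) (b := n + 2) (by omega) he
        · simpa using cone_gen (m := n + 1) (a := 1) (b := n) (by omega) he
    · rintro ⟨i, j⟩ hij
      rw [Finset.HasAntidiagonal.mem_antidiagonal] at hij
      simp only at hij ⊢
      rcases j with _ | j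
      · have : PowerSeries.coeff 0 (gf k) = 0 := by rw [gf, PowerSeries.coeff_mk]
        rw [this, mul_zero]
        exact zero_mem _
      · have h1 := cone_gen (m := i + 1) (a := 1) (b := i) (by omega) (eGen_esymm k (i + 1) (by omega))
        have h2 := cone_mul h1 (ih j (by omega))
        rwa [show i + 1 + j = n by omega] at h2

end SmirnovAux

/-- For `n ≥ 2`, `W_n^≠(x,t)` is e-unimodal and palindromic with center of
symmetry `(n-1)/2`. -/
theorem smirnov_ne_eUnimodal_palindromic (n k : ℕ) (hn : 2 ≤ n) (hk : 1 ≤ k) :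
    EUnimodal ℤ (smirnovEnum ℤ n k desc FirstNeLast) ∧
    PalinZ (smirnovEnum ℤ n k desc FirstNeLast) ((n : ℤ) - 1) := by
  obtain ⟨m, rfl⟩ : ∃ m, n = m + 1 := ⟨n - 1, by omega⟩
  have h := SmirnovAux.cone_prop (SmirnovAux.gf_mem_cone k m)
  have hg : PowerSeries.coeff (m + 1) (SmirnovAux.gf k)
      = smirnovEnum ℤ (m + 1) k desc FirstNeLast := by
    rw [SmirnovAux.gf, PowerSeries.coeff_mk]
  rw [hg] at h
  have hm : ((m + 1 : ℕ) : ℤ) - 1 = (m : ℤ) := by push_cast; ring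
  rw [hm]
  exact h

end
end

section
/- For every k ≥ 1, the following identity of formal power series in z with coefficients in ℤ[x_1,…,x_k,t] holds: D(x,t,z) · Σ_{n≥2} X_{C_n}(x,t) z^n = (1 + t^2) e_2(x) z^2 + Σ_{i≥3} ([2]_t [i]_t + i t^2 [i−3]_t) e_i(x) z^i. Consequently, for every n ≥ 2, the chromatic quasisymmetric function X_{C_n}(x,t) of the labeled cycle C_n is symmetric in x_1,…,x_k and e-positive. -/
open Finset MvPolynomial Polynomial

attribute [local instance] Classical.propDecidable

noncomputable section

/-- the t-analogue `[m]_t = 1 + t + ⋯ + t^(m-1)`, as a polynomial in `t = Polynomial.X`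
with coefficients in `R[x₁,…,x_k]` -/
def tnum (R : Type) [CommRing R] (k m : ℕ) : Polynomial (MvPolynomial (Fin k) R) :=
  ∑ j ∈ Finset.range m, Polynomial.X ^ j

/-- `D(x,t,z) = 1 - Σ_{i≥2} t[i-1]_t e_i(x) z^i`, a formal power series in `z` whose
coefficients are polynomials in `t` with coefficients in `R[x₁,…,x_k]`. -/
def Dser (R : Type) [CommRing R] (k : ℕ) : PowerSeries (Polynomial (MvPolynomial (Fin k) R)) :=
  PowerSeries.mk fun i =>
    if i = 0 then 1
    else if i = 1 then 0
    else -(Polynomial.X * tnum R k (i - 1) * Polynomial.C (esymm (Fin k) R i))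

/-- The descent number of a coloring of the labeled cycle `C_n`, whose edges are
`{i, i+1}` for `i ∈ [n-1]` together with `{1, n}`: the number of edges `{i,j}` with
`i < j` and `κ(i) > κ(j)`. -/
def descCyc {n k : ℕ} (κ : Fin n → Fin k) : ℕ :=
  desc κ + (if FirstGtLast κ then 1 else 0)

/-- `κ` is a proper coloring of the labeled cycle `C_n`. -/
def ProperCyc {n k : ℕ} (κ : Fin n → Fin k) : Prop :=
  IsSmirnov κ ∧ FirstNeLast κ

/-- The chromatic quasisymmetric function `X_{C_n}(x,t)` of the labeled cycle `C_n`,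
in the variables `x₁,…,x_k`, as a polynomial in `t` with coefficients in `R[x₁,…,x_k]`. -/
def XCyc (R : Type) [CommRing R] (n k : ℕ) : Polynomial (MvPolynomial (Fin k) R) :=
  ∑ κ ∈ Finset.univ.filter (fun κ : Fin n → Fin k => ProperCyc κ),
    Polynomial.X ^ descCyc κ * Polynomial.C (xw R κ)

/-- transfer weight -/
def Awt {S : Type*} [CommRing S] (t : S) (a b : ℕ) : S :=
  if a < b then 1 else if b < a then t else 0

lemma Awt_sum {S : Type*} [CommRing S] (t : S) (f : ℕ → S) (a j : ℕ) :
    ∑ c ∈ range j, Awt t a c * f c =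
      if j ≤ a then t * ∑ c ∈ range j, f c
      else t * ∑ c ∈ range a, f c + ∑ c ∈ range j, f c - ∑ c ∈ range (a+1), f c := by
  induction j with
  | zero => simp
  | succ j ih =>
    rw [sum_range_succ, ih]
    rcases lt_trichotomy j a with h | h | h
    · rw [if_pos h.le, if_pos (by omega), sum_range_succ, Awt, if_neg (by omega), if_pos h]; ring
    · subst h
      rw [if_pos le_rfl, if_neg (by omega), Awt, if_neg (by omega), if_neg (by omega)]; ring
    · rw [if_neg (by omega), if_neg (by omega), sum_range_succ _ j, Awt, if_pos h]; ring

lemma alg_core {S : Type*} [CommRing S] [IsDomain S] (t : S) (y f : ℕ → S) (k b : ℕ) (hb : b < k)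
    (ht : 1 - t ≠ 0) (hP : ∀ i, 1 + y i ≠ 0)
    (hf : ∀ a < k, f a = y a * ((if a = b then 1 else 0) + ∑ c ∈ range k, Awt t a c * f c)) :
    (∏ i ∈ range k, (1 + t * y i) - t * ∏ i ∈ range k, (1 + y i)) *
      ∑ a ∈ range k, Awt t a b * f a =
    y b * (∏ i ∈ Ico (b+1) k, (1 + t * y i)) *
        (∏ i ∈ range b, (1 + y i) - ∏ i ∈ range b, (1 + t * y i)) +
      t ^ 2 * (y b * (∏ i ∈ range b, (1 + y i)) *
        (∏ i ∈ Ico (b+1) k, (1 + y i) - ∏ i ∈ Ico (b+1) k, (1 + t * y i))) := by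
  set F : ℕ → S := fun j => ∑ c ∈ range j, f c with hF
  set P : ℕ → S := fun j => ∏ c ∈ range j, (1 + y c) with hPd
  set Q : ℕ → S := fun j => ∏ c ∈ range j, (1 + t * y c) with hQd
  have hP0 : ∀ j, P j ≠ 0 := fun j => prod_ne_zero_iff.2 fun i _ => hP i
  have Fs : ∀ a, F (a+1) = F a + f a := fun a => sum_range_succ _ _
  have Ps : ∀ a, P (a+1) = P a * (1 + y a) := fun a => prod_range_succ _ _
  have Qs : ∀ a, Q (a+1) = Q a * (1 + t * y a) := fun a => prod_range_succ _ _
  have hrec : ∀ a < k, F (a+1) * (1 + y a) = F a * (1 + t * y a)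
      + y a * ((if a = b then 1 else 0) + F k) := by
    intro a ha
    have h := hf a ha
    rw [Awt_sum, if_neg (show ¬ k ≤ a by omega)] at h
    have h2 := Fs a
    change f a = y a * (_ + (t * F a + F k - F (a+1))) at h
    rw [h] at h2
    linear_combination h2
  -- before b
  have h1 : ∀ a ≤ b, (1 - t) * P a * F a = F k * (P a - Q a) := by
    intro a
    induction a with
    | zero => intro _; simp [hF, hPd, hQd]
    | succ a ih =>
      intro ha
      have h := ih (by omega)
      have h2 := hrec a (by omega)
      rw [if_neg (by omega)] at h2
      rw [Ps, Qs]
      linear_combination (1 + t * y a) * h + (1 - t) * P a * h2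
  have h2 : ∀ a, b + 1 ≤ a → a ≤ k → (1 - t) * P a * F a = F k * (P a - Q a) +
      (1 - t) * (y b * P b * ∏ i ∈ Ico (b+1) a, (1 + t * y i)) := by
    intro a hba
    induction a, hba using Nat.le_induction with
    | base =>
      intro ha
      have h := h1 b le_rfl
      have h2 := hrec b hb
      rw [if_pos rfl] at h2
      rw [Ps, Qs]
      simp only [Ico_self, prod_empty]
      linear_combination (1 + t * y b) * h + (1 - t) * P b * h2
    | succ a hba ih =>
      intro ha
      have h := ih (by omega)
      have h2 := hrec a (by omega)
      rw [if_neg (by omega)] at h2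
      rw [Ps, Qs, prod_Ico_succ_top hba]
      linear_combination (1 + t * y a) * h + (1 - t) * P a * h2
  set Qb := ∏ i ∈ Ico (b+1) k, (1 + t * y i) with hQb
  set Pb := ∏ i ∈ Ico (b+1) k, (1 + y i) with hPb
  have hPk : P k = P (b+1) * Pb := (prod_range_mul_prod_Ico _ hb).symm
  have hQk : Q k = Q (b+1) * Qb := (prod_range_mul_prod_Ico _ hb).symm
  have hT : (Q k - t * P k) * F k = (1 - t) * (y b * P b * Qb) := by
    have := h2 k hb le_rfl
    linear_combination this
  have hsum : ∑ a ∈ range k, Awt t a b * f a = F b + t * (F k - F (b+1)) := by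
    have hA : ∀ j, ∑ a ∈ range j, Awt t a b * f a =
        if j ≤ b then F j else F b + t * (F j - F (b+1)) := by
      intro j
      induction j with
      | zero => simp [hF]
      | succ j ih =>
        rw [sum_range_succ, ih]
        rcases lt_trichotomy j b with h | h | h
        · rw [if_pos h.le, if_pos (by omega), Fs, Awt, if_pos h]; ring
        · subst h
          rw [if_pos le_rfl, if_neg (by omega), Awt, if_neg (by omega), if_neg (by omega)]; ring
        · rw [if_neg (by omega), if_neg (by omega), Fs j, Awt, if_neg (by omega), if_pos h]; ring
    rw [hA, if_neg (by omega)]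
  have e1 : (Q k - t * P k) * F b = y b * Qb * (P b - Q b) := by
    apply mul_left_cancel₀ (mul_ne_zero ht (hP0 b))
    linear_combination (Q k - t * P k) * h1 b le_rfl + (P b - Q b) * hT
  have e2 : (Q k - t * P k) * (F k - F (b+1)) = t * (y b * P b * (Pb - Qb)) := by
    apply mul_left_cancel₀ (mul_ne_zero ht (hP0 (b+1)))
    have h3 := h2 (b+1) le_rfl hb
    simp only [Ico_self, prod_empty] at h3
    have : (1 - t) * P (b+1) * (F k - F (b+1)) =
        F k * (Q (b+1) - t * P (b+1)) - (1 - t) * (y b * P b) := by linear_combination -h3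
    linear_combination (Q k - t * P k) * this + (Q (b+1) - t * P (b+1)) * hT
      - (1 - t) * (y b * P b) * (hQk - t * hPk)
  change (Q k - t * P k) * _ = y b * Qb * (P b - Q b) + t ^ 2 * (y b * P b * (Pb - Qb))
  rw [hsum]
  linear_combination e1 + t * e2

lemma tele {S : Type*} [CommRing S] (t : S) (y : ℕ → S) (k : ℕ) :
    (1 - t) * ∑ b ∈ range k, y b * (∏ i ∈ range b, (1 + y i)) *
        (∏ i ∈ Ico (b+1) k, (1 + t * y i)) =
      ∏ i ∈ range k, (1 + y i) - ∏ i ∈ range k, (1 + t * y i) := by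
  induction k with
  | zero => simp
  | succ k ih =>
    rw [sum_range_succ, prod_range_succ, prod_range_succ]
    have : ∑ b ∈ range k, y b * (∏ i ∈ range b, (1 + y i)) *
        (∏ i ∈ Ico (b+1) (k+1), (1 + t * y i)) = (∑ b ∈ range k, y b *
        (∏ i ∈ range b, (1 + y i)) * (∏ i ∈ Ico (b+1) k, (1 + t * y i))) * (1 + t * y k) := by
      rw [sum_mul]
      refine sum_congr rfl fun b hb => ?_
      rw [prod_Ico_succ_top (by simp at hb; omega)]; ring
    rw [this]
    simp only [Ico_self, prod_empty]
    linear_combination (1 + t * y k) * ih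

/-- `∑_b y_b ∏_{i ≠ b} (1 + s y_i)` -/
def Zs {S : Type*} [CommRing S] (s : S) (y : ℕ → S) (k : ℕ) : S :=
  ∑ b ∈ range k, y b * (∏ i ∈ range b, (1 + s * y i)) * (∏ i ∈ Ico (b+1) k, (1 + s * y i))

lemma Zs_succ {S : Type*} [CommRing S] (s : S) (y : ℕ → S) (k : ℕ) :
    Zs s y (k+1) = Zs s y k * (1 + s * y k) + y k * ∏ i ∈ range k, (1 + s * y i) := by
  unfold Zs
  rw [sum_range_succ, sum_mul]
  simp only [Ico_self, prod_empty, mul_one]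
  congr 1
  refine sum_congr rfl fun b hb => ?_
  rw [prod_Ico_succ_top (by simp at hb; omega)]; ring

lemma alg_total {S : Type*} [CommRing S] [IsDomain S] (t : S) (y : ℕ → S) (f : ℕ → ℕ → S) (k : ℕ)
    (ht : 1 - t ≠ 0) (hP : ∀ i, 1 + y i ≠ 0)
    (hf : ∀ a < k, ∀ b < k, f a b =
      y a * ((if a = b then 1 else 0) + ∑ c ∈ range k, Awt t a c * f c b)) :
    (∏ i ∈ range k, (1 + t * y i) - t * ∏ i ∈ range k, (1 + y i)) *
      ∑ b ∈ range k, ∑ a ∈ range k, Awt t a b * f a b =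
    (1 + t) * (∏ i ∈ range k, (1 + y i) - ∏ i ∈ range k, (1 + t * y i)) - Zs t y k
      + t ^ 2 * Zs 1 y k := by
  have h : ∀ b ∈ range k, _ := fun b hb => alg_core t y (fun a => f a b) k b (mem_range.1 hb) ht hP
    (fun a ha => hf a ha b (mem_range.1 hb))
  rw [mul_sum, sum_congr rfl h, ← tele]
  unfold Zs
  simp only [mul_sum, ← sum_add_distrib, ← sum_sub_distrib]
  refine sum_congr rfl fun b hb => ?_
  simp only [one_mul]
  ring

open PowerSeries in
lemma Zs_deriv {R : Type*} [CommRing R] (s : R) (x : ℕ → R) (k : ℕ) :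
    PowerSeries.C s * Zs (PowerSeries.C s) (fun i => PowerSeries.X * PowerSeries.C (x i)) k =
    PowerSeries.X * PowerSeries.derivative R (∏ i ∈ range k,
      (1 + PowerSeries.C s * (PowerSeries.X * PowerSeries.C (x i)))) := by
  induction k with
  | zero => simp [Zs]
  | succ k ih =>
    rw [Zs_succ, prod_range_succ, Derivation.leibniz, smul_eq_mul, smul_eq_mul]
    have : PowerSeries.derivative R (1 + PowerSeries.C s * (PowerSeries.X * PowerSeries.C (x k)))
        = PowerSeries.C s * PowerSeries.C (x k) := by
      simp [Derivation.leibniz]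
    rw [this]
    linear_combination (1 + PowerSeries.C s * (PowerSeries.X * PowerSeries.C (x k))) * ih

/-- The variables, indexed by naturals. -/
def xv (k : ℕ) (i : ℕ) : Polynomial (MvPolynomial (Fin k) ℤ) :=
  if h : i < k then Polynomial.C (MvPolynomial.X ⟨i, h⟩) else 0

lemma prod_esymm (k : ℕ) (s : Polynomial (MvPolynomial (Fin k) ℤ)) :
    ∏ i ∈ range k, (1 + PowerSeries.C s * (PowerSeries.X * PowerSeries.C (xv k i))) =
    PowerSeries.mk (fun n => s ^ n * Polynomial.C (esymm (Fin k) ℤ n)) := by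
  have : ∏ i ∈ range k, (1 + PowerSeries.C s * (PowerSeries.X * PowerSeries.C (xv k i))) =
      ∏ i : Fin k, (1 + PowerSeries.C (s * Polynomial.C (MvPolynomial.X i)) * PowerSeries.X) := by
    rw [prod_range]
    refine prod_congr rfl fun i _ => ?_
    simp only [xv, i.2, dif_pos, map_mul]
    ring
  rw [this, prod_one_add]
  ext1 n
  rw [map_sum, PowerSeries.coeff_mk, esymm, map_sum, mul_sum]
  rw [Finset.powersetCard_eq_filter, sum_filter]
  refine sum_congr rfl fun u _ => ?_
  rw [prod_mul_distrib, prod_const, ← map_prod, PowerSeries.coeff_C_mul, PowerSeries.coeff_X_pow,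
    prod_mul_distrib, prod_const, map_prod]
  by_cases h : u.card = n
  · simp [h]
  · simp [h, Ne.symm h]

/-- transfer recursion -/
def wn (k : ℕ) : ℕ → ℕ → ℕ → Polynomial (MvPolynomial (Fin k) ℤ)
  | 0, _, _ => 0
  | n+1, a, b => xv k a * ((if n = 0 ∧ a = b then 1 else 0) +
      ∑ c ∈ range k, Awt Polynomial.X a c * wn k n c b)

/-- word weight -/
def wt {n k : ℕ} (w : Fin (n+1) → Fin k) : Polynomial (MvPolynomial (Fin k) ℤ) :=
  (∏ i : Fin n, Awt Polynomial.X (w i.castSucc : ℕ) (w i.succ : ℕ)) *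
    ∏ i, Polynomial.C (MvPolynomial.X (w i))

lemma wt_cons {n k : ℕ} (a : Fin k) (w : Fin (n+1) → Fin k) :
    wt (Fin.cons a w : Fin (n+2) → Fin k) =
      Polynomial.C (MvPolynomial.X a) * (Awt Polynomial.X (a : ℕ) (w 0 : ℕ) * wt w) := by
  unfold wt
  rw [Fin.prod_univ_succ, Fin.prod_univ_succ (n := n+1)]
  simp only [Fin.castSucc_zero, Fin.cons_zero, Fin.cons_succ, ← Fin.succ_castSucc]
  ring

lemma sum_fcons {M : Type*} [AddCommMonoid M] {n k : ℕ} (g : (Fin (n+1) → Fin k) → M) :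
    ∑ w, g w = ∑ a : Fin k, ∑ w : Fin n → Fin k, g (Fin.cons a w) := by
  rw [← (Fin.consEquiv (fun _ => Fin k)).sum_comp, Fintype.sum_prod_type]
  rfl

lemma wn_eq {k : ℕ} (n : ℕ) (a : Fin k) (b : ℕ) :
    wn k (n+1) a b = ∑ w : Fin n → Fin k,
      if ((Fin.cons a w : Fin (n+1) → Fin k) (Fin.last n) : ℕ) = b then
        wt (Fin.cons a w : Fin (n+1) → Fin k) else 0 := by
  induction n generalizing a with
  | zero =>
    rw [Fintype.sum_unique]
    simp [wn, wt, xv]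
  | succ n ih =>
    rw [wn, sum_fcons, sum_range]
    simp only [ih, mul_sum]
    simp only [Nat.add_eq_zero_iff, one_ne_zero, and_false, false_and, if_false, zero_add, mul_sum]
    refine sum_congr rfl fun c _ => sum_congr rfl fun w _ => ?_
    rw [← Fin.succ_last, Fin.cons_succ]
    split_ifs
    · rw [wt_cons]
      simp [xv]
    · simp

lemma term_eq {k n : ℕ} (w : Fin (n+1) → Fin k) :
    (if ProperCyc w then (Polynomial.X : Polynomial (MvPolynomial (Fin k) ℤ)) ^ descCyc w
      * Polynomial.C (xw ℤ w) else 0) =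
    Awt Polynomial.X (w 0 : ℕ) (w (Fin.last n) : ℕ) * wt w := by
  by_cases h1 : IsSmirnov w
  swap
  · rw [if_neg (fun h => h1 h.1)]
    simp only [IsSmirnov, not_forall, not_not] at h1
    obtain ⟨i, hi, h⟩ := h1
    unfold wt
    rw [prod_eq_zero (i := (⟨i, by omega⟩ : Fin n)) (mem_univ _)]
    · simp
    · have : w (Fin.succ ⟨i, by omega⟩) = w (Fin.castSucc ⟨i, by omega⟩) := h
      rw [this]
      simp [Awt]
  have hne : FirstNeLast w ↔ w 0 ≠ w (Fin.last n) := by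
    constructor
    · rintro ⟨_, h⟩; exact h
    · intro h; exact ⟨Nat.succ_pos n, h⟩
  have hgt : FirstGtLast w ↔ w (Fin.last n) < w 0 := by
    constructor
    · rintro ⟨_, h⟩; exact h
    · intro h; exact ⟨Nat.succ_pos n, h⟩
  by_cases h2 : w 0 = w (Fin.last n)
  · rw [if_neg (fun h => hne.1 h.2 h2), h2]
    simp [Awt]
  rw [if_pos ⟨h1, hne.2 h2⟩, descCyc, pow_add]
  have hd : (Polynomial.X : Polynomial (MvPolynomial (Fin k) ℤ)) ^ desc w =
      ∏ i : Fin n, Awt Polynomial.X (w i.castSucc : ℕ) (w i.succ : ℕ) := by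
    unfold desc
    rw [card_filter, Fin.sum_univ_castSucc, if_neg (by rintro ⟨h, _⟩; simp at h),
      add_zero, ← prod_pow_eq_pow_sum]
    refine prod_congr rfl fun i _ => ?_
    have hs : w i.succ ≠ w i.castSucc := h1 i.castSucc (Nat.succ_lt_succ i.2)
    have hiff : (∃ h : (i.castSucc : ℕ) + 1 < n + 1, w ⟨(i.castSucc : ℕ) + 1, h⟩ < w i.castSucc) ↔
        w i.succ < w i.castSucc := by
      constructor
      · rintro ⟨_, h⟩; exact h
      · intro h; exact ⟨Nat.succ_lt_succ i.2, h⟩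
    unfold Awt
    rcases lt_or_gt_of_ne hs with h | h
    · rw [if_pos (hiff.2 h), if_neg (not_lt.2 (Fin.le_def.1 h.le)), if_pos (Fin.lt_def.1 h), pow_one]
    · rw [if_neg (fun h' => lt_asymm h (hiff.1 h')), if_pos (Fin.lt_def.1 h), pow_zero]
  have he : (Polynomial.X : Polynomial (MvPolynomial (Fin k) ℤ)) ^
      (if FirstGtLast w then 1 else 0) = Awt Polynomial.X (w 0 : ℕ) (w (Fin.last n) : ℕ) := by
    unfold Awt
    rcases lt_or_gt_of_ne h2 with h | h
    · rw [if_neg (fun h' => lt_asymm h (hgt.1 h')), if_pos (Fin.lt_def.1 h), pow_zero]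
    · rw [if_pos (hgt.2 h), if_neg (not_lt.2 (Fin.le_def.1 h.le)), if_pos (Fin.lt_def.1 h), pow_one]
  rw [hd, he, wt, xw, map_prod]
  ring

lemma XCyc_eq (k n : ℕ) : XCyc ℤ (n+1) k =
    ∑ b ∈ range k, ∑ a ∈ range k, Awt Polynomial.X a b * wn k (n+1) a b := by
  unfold XCyc
  rw [sum_filter, sum_congr rfl (fun w _ => term_eq w), sum_fcons]
  conv_rhs => rw [sum_comm, sum_range]
  refine sum_congr rfl fun a _ => ?_
  simp only [wn_eq, mul_sum]
  rw [sum_comm]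
  refine sum_congr rfl fun w _ => ?_
  simp only [mul_ite, mul_zero]
  rw [sum_ite_eq, if_pos (by simp), Fin.cons_zero]

lemma wn_series (k a b : ℕ) :
    (PowerSeries.mk fun n => wn k n a b) = PowerSeries.X * PowerSeries.C (xv k a) *
      ((if a = b then 1 else 0) + ∑ c ∈ range k, Awt (PowerSeries.C Polynomial.X) a c *
        PowerSeries.mk fun n => wn k n c b) := by
  have hA : ∀ c, (Awt (PowerSeries.C (Polynomial.X : Polynomial (MvPolynomial (Fin k) ℤ))) a c) =
      PowerSeries.C (Awt Polynomial.X a c) := by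
    intro c; unfold Awt; split_ifs <;> simp
  ext1 n
  rw [mul_assoc]
  cases n with
  | zero => simp [wn]
  | succ n =>
    rw [PowerSeries.coeff_succ_X_mul, PowerSeries.coeff_C_mul, PowerSeries.coeff_mk, wn, map_add,
      map_sum]
    simp only [hA, PowerSeries.coeff_C_mul, PowerSeries.coeff_mk]
    congr 2
    by_cases h : a = b
    · simp [h, PowerSeries.coeff_one]
    · simp [h]

lemma tnum_mul (k m : ℕ) : (1 - Polynomial.X) * tnum ℤ k m = 1 - Polynomial.X ^ m := by
  unfold tnum
  exact mul_neg_geom_sum _ _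

lemma one_sub_X_ne (k : ℕ) : (1 - Polynomial.X : Polynomial (MvPolynomial (Fin k) ℤ)) ≠ 0 := by
  intro h
  have := congrArg (fun p => Polynomial.coeff p 1) h
  simp [Polynomial.coeff_one] at this

lemma main_identity (k : ℕ) :
    Dser ℤ k * PowerSeries.mk (fun n => if 2 ≤ n then XCyc ℤ n k else 0) =
    PowerSeries.mk (fun i =>
      if i = 2 then (1 + Polynomial.X ^ 2) * Polynomial.C (esymm (Fin k) ℤ 2)
      else if 3 ≤ i then
        (tnum ℤ k 2 * tnum ℤ k i +
            (i : Polynomial (MvPolynomial (Fin k) ℤ)) * Polynomial.X ^ 2 * tnum ℤ k (i - 3)) *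
          Polynomial.C (esymm (Fin k) ℤ i)
      else 0) := by
  set y : ℕ → PowerSeries (Polynomial (MvPolynomial (Fin k) ℤ)) :=
    fun i => PowerSeries.X * PowerSeries.C (xv k i) with hy
  set τ : PowerSeries (Polynomial (MvPolynomial (Fin k) ℤ)) := PowerSeries.C Polynomial.X with hτ
  have h1t : 1 - τ = PowerSeries.C (1 - Polynomial.X) := by simp [hτ]
  have ht : 1 - τ ≠ 0 := by
    rw [h1t]
    intro h
    exact one_sub_X_ne k (PowerSeries.C_injective (h.trans (map_zero _).symm))
  have hP : ∀ i, 1 + y i ≠ 0 := by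
    intro i h
    have := congrArg (PowerSeries.constantCoeff) h
    simp [hy] at this
  have key := alg_total τ y (fun a b => PowerSeries.mk fun n => wn k n a b) k ht hP
    (fun a _ b _ => wn_series k a b)
  have hX : ∑ b ∈ range k, ∑ a ∈ range k, Awt τ a b * (PowerSeries.mk fun n => wn k n a b) =
      PowerSeries.mk (fun n => if 2 ≤ n then XCyc ℤ n k else 0) := by
    have hA : ∀ a b, Awt τ a b = PowerSeries.C (Awt Polynomial.X a b) := by
      intro a b; unfold Awt; split_ifs <;> simp [hτ]
    ext1 n
    simp only [map_sum, hA, PowerSeries.coeff_C_mul, PowerSeries.coeff_mk]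
    match n with
    | 0 => simp [wn]
    | 1 =>
      rw [if_neg (by omega)]
      refine sum_eq_zero fun b _ => sum_eq_zero fun a _ => ?_
      by_cases h : a = b
      · simp [Awt, h]
      · simp [wn, h]
    | n+2 => rw [if_pos (by omega), XCyc_eq]
  have hQs := prod_esymm k Polynomial.X
  have hPs := prod_esymm k 1
  have hZ1 := Zs_deriv 1 (xv k) k
  have hZt := Zs_deriv Polynomial.X (xv k) k
  rw [hPs] at hZ1
  rw [hQs] at hZt
  simp only [map_one, one_mul] at hPs hZ1
  change ∏ i ∈ range k, (1 + τ * y i) = _ at hQs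
  change ∏ i ∈ range k, (1 + y i) = _ at hPs
  change Zs 1 y k = _ at hZ1
  change τ * Zs τ y k = _ at hZt
  have hZt' : Zs τ y k = PowerSeries.mk (fun n => (n : Polynomial (MvPolynomial (Fin k) ℤ)) *
      Polynomial.X ^ (n-1) * Polynomial.C (esymm (Fin k) ℤ n)) := by
    have h0 : τ ≠ 0 := by
      intro h
      exact Polynomial.X_ne_zero (PowerSeries.C_injective (h.trans (map_zero _).symm))
    apply mul_left_cancel₀ h0
    rw [hZt]
    ext1 n
    rw [hτ, PowerSeries.coeff_C_mul, PowerSeries.coeff_mk]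
    cases n with
    | zero => simp
    | succ n =>
      rw [PowerSeries.coeff_succ_X_mul, PowerSeries.coeff_derivative, PowerSeries.coeff_mk]
      push_cast
      ring
  have hZ1' : Zs 1 y k = PowerSeries.mk (fun n => (n : Polynomial (MvPolynomial (Fin k) ℤ)) *
      Polynomial.C (esymm (Fin k) ℤ n)) := by
    rw [hZ1]
    ext1 n
    rw [PowerSeries.coeff_mk]
    cases n with
    | zero => simp
    | succ n =>
      rw [PowerSeries.coeff_succ_X_mul, PowerSeries.coeff_derivative, PowerSeries.coeff_mk]
      push_cast
      ring
  rw [hX, hQs, hPs, hZt', hZ1'] at key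
  have hD : (1 - τ) * Dser ℤ k =
      PowerSeries.mk (fun n => Polynomial.X ^ n * Polynomial.C (esymm (Fin k) ℤ n)) -
      τ * PowerSeries.mk (fun n => 1 ^ n * Polynomial.C (esymm (Fin k) ℤ n)) := by
    ext1 n
    rw [h1t, hτ, map_sub (PowerSeries.coeff n), PowerSeries.coeff_C_mul, PowerSeries.coeff_C_mul, Dser]
    simp only [PowerSeries.coeff_mk]
    match n with
    | 0 => simp
    | 1 => simp
    | n+2 =>
      rw [if_neg (by omega), if_neg (by omega)]
      have := tnum_mul k (n+1)
      rw [show n + 2 - 1 = n + 1 by omega]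
      rw [one_pow]
      linear_combination (-Polynomial.X * Polynomial.C (esymm (Fin k) ℤ (n+2))) * this
  apply mul_left_cancel₀ ht
  simp only [one_pow, one_mul] at hD key
  rw [← mul_assoc, hD, key]
  ext1 n
  rw [h1t, show 1 + τ = PowerSeries.C (1 + Polynomial.X) by simp [hτ],
    show τ ^ 2 = PowerSeries.C (Polynomial.X ^ 2) by simp [hτ]]
  rw [map_add (PowerSeries.coeff n), map_sub (PowerSeries.coeff n), PowerSeries.coeff_C_mul,
    PowerSeries.coeff_C_mul, PowerSeries.coeff_C_mul, map_sub (PowerSeries.coeff n)]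
  simp only [PowerSeries.coeff_mk]
  match n with
  | 0 => simp
  | 1 => simp; ring
  | 2 => simp; ring
  | n+3 =>
    rw [if_neg (by omega), if_pos (by omega), show n + 3 - 3 = n by omega,
      show n + 3 - 1 = n + 2 by omega]
    have h1 := tnum_mul k (n+3)
    have h2 := tnum_mul k n
    have h3 : tnum ℤ k 2 = 1 + Polynomial.X := by simp [tnum, sum_range_succ]
    rw [h3]
    linear_combination (-Polynomial.C (esymm (Fin k) ℤ (n+3))) * ((1 + Polynomial.X) * h1 +
      ((n + 3 : ℕ) : Polynomial (MvPolynomial (Fin k) ℤ)) * Polynomial.X ^ 2 * h2)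

/-- The evaluation used for `e`-positivity. -/
def ePhi (k : ℕ) : MvPolynomial ℕ (Polynomial ℕ) →+* Polynomial (MvPolynomial (Fin k) ℤ) :=
  MvPolynomial.eval₂Hom
    (Polynomial.mapRingHom (Nat.castRingHom (MvPolynomial (Fin k) ℤ)))
    (fun i => Polynomial.C (esymm (Fin k) ℤ (i+1)))

lemma EPosT_of_ePhi (k : ℕ) (p : MvPolynomial ℕ (Polynomial ℕ)) : EPosT ℤ (ePhi k p) := by
  let φ : (ℕ →₀ ℕ) → Multiset ℕ := fun d => (Finsupp.toMultiset d).map (· + 1)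
  let ψ : Multiset ℕ → (ℕ →₀ ℕ) := fun μ => Multiset.toFinsupp (μ.map (· - 1))
  have hψφ : ∀ d, ψ (φ d) = d := by
    intro d
    simp [ψ, φ]
  have hinj : Function.Injective φ := Function.LeftInverse.injective hψφ
  refine ⟨p.support.image φ, fun μ => (p.coeff (ψ μ)).map (Nat.castRingHom ℤ), ?_, ?_, ?_⟩
  · intro μ hμ i hi
    obtain ⟨d, _, rfl⟩ := mem_image.1 hμ
    obtain ⟨j, _, rfl⟩ := Multiset.mem_map.1 hi
    omega
  · intro μ _ j
    simp
  · rw [sum_image (fun a _ b _ h => hinj h)]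
    change MvPolynomial.eval₂ _ _ p = _
    rw [MvPolynomial.eval₂_eq]
    refine sum_congr rfl fun d _ => ?_
    beta_reduce
    rw [hψφ, Polynomial.map_map]
    congr 1
    simp only [φ, Multiset.map_map, Finsupp.toMultiset_apply, Finsupp.sum, Function.comp_apply]
    rw [← Multiset.coe_mapAddMonoidHom, map_sum, Multiset.prod_sum, map_prod]
    refine prod_congr rfl fun i _ => ?_
    rw [map_nsmul, Multiset.prod_nsmul]
    simp

lemma SymmX_of_EPosT (k : ℕ) (P : Polynomial (MvPolynomial (Fin k) ℤ)) (h : EPosT ℤ P) :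
    SymmX ℤ P := by
  obtain ⟨S, c, -, -, rfl⟩ := h
  intro j
  rw [Polynomial.finsetSum_coeff]
  refine Subalgebra.sum_mem (symmetricSubalgebra (Fin k) ℤ) fun μ _ => ?_
  rw [Polynomial.coeff_mul_C, Polynomial.coeff_map]
  refine Subalgebra.mul_mem _ (MvPolynomial.IsSymmetric.C _) ?_
  refine multiset_prod_mem (S := symmetricSubalgebra (Fin k) ℤ) _ ?_
  intro a ha
  obtain ⟨i, _, rfl⟩ := Multiset.mem_map.1 ha
  exact esymm_isSymmetric _ _ _

lemma XCyc_mem (k n : ℕ) (hn : 2 ≤ n) : XCyc ℤ n k ∈ (ePhi k).rangeS := by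
  induction n using Nat.strong_induction_on with
  | _ n ih =>
  have hXm : (Polynomial.X : Polynomial (MvPolynomial (Fin k) ℤ)) ∈ (ePhi k).rangeS :=
    ⟨MvPolynomial.C Polynomial.X, by simp [ePhi]⟩
  have hem : ∀ i, 1 ≤ i → Polynomial.C (esymm (Fin k) ℤ i) ∈ (ePhi k).rangeS := fun i hi =>
    ⟨MvPolynomial.X (i-1), by simp [ePhi, Nat.sub_add_cancel hi]⟩
  have htm : ∀ m, tnum ℤ k m ∈ (ePhi k).rangeS := fun m =>
    sum_mem fun j _ => pow_mem hXm j
  have h := congrArg (PowerSeries.coeff n) (main_identity k)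
  rw [PowerSeries.coeff_mul, Finset.Nat.sum_antidiagonal_eq_sum_range_succ_mk,
    sum_range_succ'] at h
  simp only [Dser, PowerSeries.coeff_mk, if_true, Nat.sub_zero, if_pos hn, one_mul] at h
  have h2 := eq_sub_of_add_eq' h
  rw [h2, sub_eq_add_neg, ← sum_neg_distrib]
  refine add_mem ?_ (sum_mem fun i hi => ?_)
  · split_ifs with h3 h4
    · exact mul_mem (add_mem (one_mem _) (pow_mem hXm 2)) (hem 2 (by omega))
    · exact mul_mem (add_mem (mul_mem (htm _) (htm _))
        (mul_mem (mul_mem (natCast_mem _ _) (pow_mem hXm _)) (htm _))) (hem _ (by omega))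
    · exact zero_mem _
  · rw [if_neg (by omega)]
    by_cases hi0 : i + 1 = 1
    · rw [if_pos hi0]; simp
    · rw [if_neg hi0, show ∀ A B : Polynomial (MvPolynomial (Fin k) ℤ), -(-A * B) = A * B from
        fun A B => by ring]
      refine mul_mem (mul_mem (mul_mem hXm (htm _)) (hem _ (by omega))) ?_
      split_ifs with h5
      · exact ih _ (by omega) h5
      · exact zero_mem _

/-- `D(x,t,z) · Σ_{n≥2} X_{C_n}(x,t) z^n
= (1+t²) e_2(x) z² + Σ_{i≥3} ([2]_t [i]_t + i t² [i-3]_t) e_i(x) z^i`;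
consequently each `X_{C_n}(x,t)` (`n ≥ 2`) is symmetric in `x₁,…,x_k` and e-positive. -/
theorem chromatic_cycle_enumerator (k : ℕ) (hk : 1 ≤ k) :
    (Dser ℤ k * PowerSeries.mk (fun n => if 2 ≤ n then XCyc ℤ n k else 0) =
    PowerSeries.mk (fun i =>
      if i = 2 then (1 + Polynomial.X ^ 2) * Polynomial.C (esymm (Fin k) ℤ 2)
      else if 3 ≤ i then
        (tnum ℤ k 2 * tnum ℤ k i +
            (i : Polynomial (MvPolynomial (Fin k) ℤ)) * Polynomial.X ^ 2 * tnum ℤ k (i - 3)) *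
          Polynomial.C (esymm (Fin k) ℤ i)
      else 0)) ∧
    ∀ n : ℕ, 2 ≤ n → SymmX ℤ (XCyc ℤ n k) ∧ EPosT ℤ (XCyc ℤ n k) := by
  exact ⟨main_identity k, fun n hn => by
    obtain ⟨p, hp⟩ := XCyc_mem k n hn
    have h : EPosT ℤ (XCyc ℤ n k) := hp ▸ EPosT_of_ePhi k p
    exact ⟨SymmX_of_EPosT k _ h, h⟩⟩

end
end

section
/- For every even integer n ≥ 2 and every k ≥ 1, the polynomial X_{C_n}(x,t) + t^{n/2} e_2(x)^{n/2}, regarded as a polynomial in t with coefficients symmetric polynomials in x_1,…,x_k, is e-unimodal and palindromic with center of symmetry n/2; in particular X_{C_n}(x,t) itself is palindromic with center of symmetry n/2. -/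
open Finset MvPolynomial Polynomial

attribute [local instance] Classical.propDecidable

noncomputable section

theorem det_affine {R : Type} [CommRing R] {k : ℕ} (M : Matrix (Fin k) (Fin k) R) (v : Fin k → R) :
    ∃ β : R, ∀ y : R, (Matrix.of fun i j => M i j + y * v i).det = M.det + y * β := by
  let N : Matrix (Fin k ⊕ Unit) (Fin k ⊕ Unit) R :=
    Matrix.fromBlocks M (Matrix.of fun i _ => - v i) 0 1
  refine ⟨(N.updateRow (Sum.inr ()) (Sum.elim 1 0)).det, fun y => ?_⟩
  have h1 : (Matrix.of fun i j => M i j + y * v i) =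
      M - (Matrix.of fun i (_ : Unit) => - v i) * (Matrix.of fun (_ : Unit) (_ : Fin k) => y) := by
    ext i j
    simp [Matrix.mul_apply]; ring
  have h2 : Matrix.fromBlocks M (Matrix.of fun i (_ : Unit) => - v i)
      (Matrix.of fun (_ : Unit) (_ : Fin k) => y) 1 =
      N.updateRow (Sum.inr ()) ((Sum.elim 0 1 : Fin k ⊕ Unit → R) + y • (Sum.elim 1 0 : Fin k ⊕ Unit → R)) := by
    ext i j
    rcases i with i | i <;> rcases j with j | j <;> simp [N, Matrix.updateRow_apply]
  have h3 : N.updateRow (Sum.inr ()) (Sum.elim 0 1) = N := by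
    ext i j
    rcases i with i | i <;> rcases j with j | j <;> simp [N, Matrix.updateRow_apply]
  rw [h1, ← Matrix.det_fromBlocks_one₂₂, h2, Matrix.det_updateRow_add, Matrix.det_updateRow_smul, h3]
  congr 1
  simp [N]

/-- elementary symmetric value -/
def eval_e {R : Type} [CommRing R] {k : ℕ} (x : Fin k → R) (i : ℕ) : R :=
  ∑ T ∈ Finset.powersetCard i Finset.univ, ∏ j ∈ T, x j

def hh {R : Type} [CommRing R] (s u : R) (i : ℕ) : R := ∑ j ∈ Finset.Ico 1 i, s ^ j * u ^ (i - j)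

theorem prod_eval_e {R : Type} [CommRing R] {k : ℕ} (x : Fin k → R) (s : R) :
    ∏ i, (1 + s * x i) = ∑ i ∈ Finset.range (k + 1), s ^ i * eval_e x i := by
  rw [Finset.prod_one_add, Finset.sum_powerset]
  simp only [Finset.card_univ, Fintype.card_fin]
  refine Finset.sum_congr rfl fun i _ => ?_
  rw [eval_e, Finset.mul_sum]
  refine Finset.sum_congr rfl fun T hT => ?_
  rw [Finset.prod_mul_distrib, Finset.prod_const, (Finset.mem_powersetCard.1 hT).2]

def trMat {R : Type} [CommRing R] {k : ℕ} (s u : R) (x : Fin k → R) : Matrix (Fin k) (Fin k) R :=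
  Matrix.of fun i j => x i * (if j < i then s else if i < j then u else 0)

theorem hh_mul {R : Type} [CommRing R] (s u : R) (i : ℕ) :
    u * s ^ (i + 1) - s * u ^ (i + 1) = - ((u - s) * hh s u (i + 1)) := by
  have h : hh s u (i + 1) = s * u * ∑ j ∈ Finset.range i, s ^ j * u ^ (i - 1 - j) := by
    rw [hh, Finset.sum_Ico_eq_sum_range, Finset.mul_sum]
    refine Finset.sum_congr rfl fun j hj => ?_
    have hj' := Finset.mem_range.1 hj
    have : i + 1 - (1 + j) = (i - 1 - j) + 1 := by omega
    rw [this]; ring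
  have := Commute.geom_sum₂_mul (Commute.all s u) i
  rw [h]
  linear_combination -(s * u) * this

theorem det_formula_mul {R : Type} [CommRing R] {k : ℕ} (s u : R) (x : Fin k → R) :
    (u - s) * (1 - trMat s u x).det =
      (u - s) * (1 - ∑ i ∈ Finset.range (k + 1), hh s u i * eval_e x i) := by
  obtain ⟨β, hβ⟩ := det_affine (1 - trMat s u x) x
  have hs : ∏ i, (1 + s * x i) = (1 - trMat s u x).det + s * β := by
    rw [← hβ, Matrix.det_of_isUpperTriangular]
    · simp [trMat]
    · intro i j hij
      have hij : j < i := hij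
      simp [trMat, hij, hij.ne', Matrix.one_apply]; ring
  have hu : ∏ i, (1 + u * x i) = (1 - trMat s u x).det + u * β := by
    rw [← hβ, Matrix.det_of_isLowerTriangular]
    · simp [trMat]
    · intro i j hij
      have hij : i < j := hij
      simp [trMat, hij, hij.ne, hij.not_gt, Matrix.one_apply]; ring
  rw [prod_eval_e] at hs hu
  have h1 : (u - s) * (1 - trMat s u x).det =
      ∑ i ∈ Finset.range (k + 1), (u * s ^ i - s * u ^ i) * eval_e x i := by
    have : ∑ i ∈ Finset.range (k + 1), (u * s ^ i - s * u ^ i) * eval_e x i =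
      u * (∑ i ∈ Finset.range (k + 1), s ^ i * eval_e x i) -
      s * (∑ i ∈ Finset.range (k + 1), u ^ i * eval_e x i) := by
      rw [Finset.mul_sum, Finset.mul_sum, ← Finset.sum_sub_distrib]
      exact Finset.sum_congr rfl fun i _ => by ring
    rw [this, hs, hu]; ring
  rw [h1, Finset.sum_range_succ', Finset.sum_range_succ']
  simp only [hh_mul]
  have e0 : eval_e x 0 = 1 := by simp [eval_e]
  have h0 : hh s u 0 = 0 := by simp [hh]
  rw [e0, h0, mul_sub, mul_add, Finset.mul_sum]
  simp only [neg_mul, Finset.sum_neg_distrib, mul_assoc]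
  ring

theorem det_formula {R : Type} [CommRing R] [IsDomain R] {k : ℕ} (s u : R) (hsu : u - s ≠ 0)
    (x : Fin k → R) :
    (1 - trMat s u x).det = 1 - ∑ i ∈ Finset.range (k + 1), hh s u i * eval_e x i :=
  mul_left_cancel₀ hsu (det_formula_mul s u x)

theorem jacobi {L : Type} [CommRing L] {k : ℕ} (M N G : Matrix (Fin k) (Fin k) L)
    (hG : M * G = 1) :
    (M.map Polynomial.C + (Polynomial.X : Polynomial L) • N.map Polynomial.C).det.coeff 1 =
      M.det * (G * N).trace ∧
    (M.map Polynomial.C + (Polynomial.X : Polynomial L) • N.map Polynomial.C).det.coeff 0 =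
      M.det := by
  have h : M.map Polynomial.C + (Polynomial.X : Polynomial L) • N.map Polynomial.C =
      M.map Polynomial.C * (1 + (Polynomial.X : Polynomial L) • (G * N).map Polynomial.C) := by
    have : (N.map Polynomial.C : Matrix _ _ (Polynomial L)) =
        M.map Polynomial.C * (G * N).map Polynomial.C := by
      rw [← Matrix.map_mul, ← mul_assoc, hG, one_mul]
    rw [mul_add, mul_one, Matrix.mul_smul, ← this]
  have h2 : (M.map Polynomial.C : Matrix _ _ (Polynomial L)).det = Polynomial.C M.det := by
    rw [← RingHom.mapMatrix_apply, ← RingHom.map_det]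
  rw [h, Matrix.det_mul, h2, Polynomial.coeff_C_mul, Polynomial.coeff_C_mul,
    Matrix.coeff_det_one_add_X_smul_one]
  refine ⟨rfl, ?_⟩
  rw [Polynomial.coeff_zero_eq_eval_zero, _root_.eval_det_add_X_smul]
  simp

theorem walk_sum {R : Type} [CommRing R] {k : ℕ} (A : Matrix (Fin k) (Fin k) R) (m : ℕ) :
    ∀ F : Fin k → Fin k → R,
    ∑ w : Fin (m + 1) → Fin k, (∏ l : Fin m, A (w l.castSucc) (w l.succ)) * F (w 0) (w (Fin.last m))
      = ∑ i, ∑ j, (A ^ m) i j * F i j := by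
  induction m with
  | zero =>
    intro F
    rw [← (Equiv.funUnique (Fin 1) (Fin k)).symm.sum_comp]
    simp [Matrix.one_apply]
  | succ m ih =>
    intro F
    rw [← (Fin.consEquiv (fun _ => Fin k)).sum_comp, Fintype.sum_prod_type]
    refine Finset.sum_congr rfl fun a _ => ?_
    have := ih (fun i j => A a i * F a j)
    simp only [Fin.consEquiv_apply, Fin.prod_univ_succ, Fin.castSucc_zero, Fin.cons_zero,
      Fin.cons_succ, ← Fin.succ_castSucc, ← Fin.succ_last]
    rw [pow_succ']
    simp only [Matrix.mul_apply, Finset.sum_mul]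
    rw [Finset.sum_comm (s := Finset.univ) (t := Finset.univ) (f := fun j i => A a i * (A ^ m) i j * F a j)]
    calc _ = _ := Finset.sum_congr rfl fun w _ => by ring
      _ = _ := this
      _ = _ := Finset.sum_congr rfl fun i _ => Finset.sum_congr rfl fun j _ => by ring

def cc {R : Type} [CommRing R] (t : R) (i : ℕ) : R :=
  ∑ j ∈ Finset.Ico 1 i, ((j : R) * t ^ (j - 1) + ((i - j : ℕ) : R) * t ^ (j + 1))

theorem hh_coeff {L : Type} [CommRing L] (τ : L) (i : ℕ) :
    (hh (Polynomial.C τ + Polynomial.X) (1 + Polynomial.X * Polynomial.C τ) i).coeff 0 = hh τ 1 i ∧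
    (hh (Polynomial.C τ + Polynomial.X) (1 + Polynomial.X * Polynomial.C τ) i).coeff 1 = cc τ i := by
  constructor
  · simp [hh, Polynomial.coeff_zero_eq_eval_zero, Polynomial.eval_finsetSum]
  · have h : ∀ p : Polynomial L, p.coeff 1 = (Polynomial.derivative p).eval 0 := by
      intro p
      simp [← Polynomial.coeff_zero_eq_eval_zero, Polynomial.coeff_derivative]
    rw [h, hh, cc, Polynomial.derivative_sum, Polynomial.eval_finsetSum]
    refine Finset.sum_congr rfl fun j _ => ?_
    simp [Polynomial.derivative_pow]
    ring

theorem eval_e_esymm (k i : ℕ) :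
    eval_e (fun j : Fin k => (Polynomial.C (MvPolynomial.X j : MvPolynomial (Fin k) ℤ))) i =
      Polynomial.C (esymm (Fin k) ℤ i) := by
  simp [eval_e, esymm, map_sum, map_prod]

theorem eval_e_map {R S : Type} [CommRing R] [CommRing S] (f : R →+* S) {k : ℕ} (z : S)
    (x : Fin k → R) (i : ℕ) :
    eval_e (fun j => z * f (x j)) i = z ^ i * f (eval_e x i) := by
  rw [eval_e, eval_e, map_sum, Finset.mul_sum]
  refine Finset.sum_congr rfl fun T hT => ?_
  rw [Finset.prod_mul_distrib, Finset.prod_const, (Finset.mem_powersetCard.1 hT).2, map_prod]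

theorem eval_e_big {R : Type} [CommRing R] {k : ℕ} (x : Fin k → R) (i : ℕ) (h : k < i) :
    eval_e x i = 0 := by
  rw [eval_e, Finset.powersetCard_eq_empty.2 (by simpa using h)]
  rfl

theorem hh_map {R S : Type} [CommRing R] [CommRing S] (f : R →+* S) (s u : R) (i : ℕ) :
    hh (f s) (f u) i = f (hh s u i) := by simp [hh]

theorem cc_map {R S : Type} [CommRing R] [CommRing S] (f : R →+* S) (s : R) (i : ℕ) :
    cc (f s) i = f (cc s i) := by simp [cc]

theorem ps_sum {R : Type} [CommRing R] (k : ℕ) (a : ℕ → R) (ha : ∀ i, k < i → a i = 0) :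
    ∑ i ∈ Finset.range (k + 1), PowerSeries.C (a i) * (PowerSeries.X : PowerSeries R) ^ i =
      PowerSeries.mk a := by
  ext n
  rw [map_sum, PowerSeries.coeff_mk]
  simp only [PowerSeries.coeff_C_mul, PowerSeries.coeff_X_pow, mul_ite, mul_one, mul_zero]
  rw [Finset.sum_ite_eq]
  split_ifs with h
  · rfl
  · exact (ha n (by simpa using h)).symm

/-- main generating function identity, for a domain `R` -/
theorem gen_identity {R : Type} [CommRing R] [IsDomain R] {k : ℕ} (t : R) (ht : t ≠ 1)
    (x : Fin k → R) :
    (1 - PowerSeries.mk fun i => hh t 1 i * eval_e x i) *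
      (PowerSeries.X * PowerSeries.mk fun m => ((trMat t 1 x) ^ m * trMat 1 t x).trace) =
      PowerSeries.mk fun i => cc t i * eval_e x i := by
  set A := trMat t 1 x with hA
  set B := trMat 1 t x with hB
  let Cz : R →+* PowerSeries R := PowerSeries.C
  let z : PowerSeries R := PowerSeries.X
  let M : Matrix (Fin k) (Fin k) (PowerSeries R) := 1 - z • A.map Cz
  let N : Matrix (Fin k) (Fin k) (PowerSeries R) := - (z • B.map Cz)
  let G : Matrix (Fin k) (Fin k) (PowerSeries R) :=
    Matrix.of fun i j => PowerSeries.mk fun n => (A ^ n) i j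
  have hG : M * G = 1 := by
    have : G = 1 + z • (A.map Cz * G) := by
      ext i j n
      rcases n with _ | n
      · simp only [G, Matrix.of_apply, PowerSeries.coeff_mk, pow_zero, Matrix.add_apply,
          Matrix.smul_apply, smul_eq_mul, map_add, z, PowerSeries.coeff_zero_X_mul, add_zero,
          Matrix.one_apply]
        split_ifs <;> simp
      · simp only [G, Matrix.of_apply, PowerSeries.coeff_mk, Matrix.add_apply,
          Matrix.smul_apply, smul_eq_mul, map_add, z, PowerSeries.coeff_succ_X_mul,
          Matrix.one_apply, Matrix.mul_apply, map_sum, Matrix.map_apply, Cz,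
          PowerSeries.coeff_C_mul, pow_succ']
        split_ifs <;> simp [PowerSeries.coeff_one]
    have h2 : M * G = G - z • (A.map Cz * G) := by
      simp only [M, sub_mul, one_mul, Matrix.smul_mul]
    rw [h2]
    nth_rewrite 1 [this]
    simp
  obtain ⟨j1, j0⟩ := jacobi M N G hG
  let τ : PowerSeries R := Cz t
  let s : Polynomial (PowerSeries R) := Polynomial.C τ + Polynomial.X
  let u : Polynomial (PowerSeries R) := 1 + Polynomial.X * Polynomial.C τ
  have hsu : u - s ≠ 0 := by
    intro h
    have h' := congrArg (fun p => p.coeff 0) h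
    simp [u, s, τ, Cz, sub_eq_zero] at h'
    have h'' := congrArg (PowerSeries.coeff 0) h'
    simp at h''
    exact ht h''.symm
  have hM : M.map Polynomial.C + (Polynomial.X : Polynomial (PowerSeries R)) • N.map Polynomial.C =
      1 - trMat s u (fun j => Polynomial.C z * (Polynomial.C.comp Cz) (x j)) := by
    ext1 i j
    simp only [M, N, hA, hB, trMat, Matrix.add_apply, Matrix.map_apply, Matrix.sub_apply,
      Matrix.smul_apply, Matrix.neg_apply, Matrix.of_apply, smul_eq_mul, map_sub, map_mul, map_neg,
      Matrix.one_apply, RingHom.comp_apply, s, u, τ]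
    split_ifs <;> simp <;> ring
  rw [hM, det_formula s u hsu] at j1 j0
  have hsum : ∀ q : ℕ, (∑ i ∈ Finset.range (k + 1), hh s u i *
      eval_e (fun j => Polynomial.C z * (Polynomial.C.comp Cz) (x j)) i).coeff q =
      ∑ i ∈ Finset.range (k + 1), ((hh s u i).coeff q * Cz (eval_e x i)) * z ^ i := by
    intro q
    rw [Polynomial.finsetSum_coeff]
    refine Finset.sum_congr rfl fun i _ => ?_
    rw [eval_e_map, ← map_pow, RingHom.comp_apply, ← map_mul, Polynomial.coeff_mul_C]
    ring
  rw [Polynomial.coeff_sub, hsum] at j1 j0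
  have hS0 : ∑ i ∈ Finset.range (k + 1), ((hh s u i).coeff 0 * Cz (eval_e x i)) * z ^ i =
      PowerSeries.mk fun i => hh t 1 i * eval_e x i := by
    rw [← ps_sum k _ (fun i hi => by rw [eval_e_big x i hi, mul_zero])]
    refine Finset.sum_congr rfl fun i _ => ?_
    rw [(hh_coeff τ i).1, ← map_one Cz, hh_map, map_mul]
  have hS1 : ∑ i ∈ Finset.range (k + 1), ((hh s u i).coeff 1 * Cz (eval_e x i)) * z ^ i =
      PowerSeries.mk fun i => cc t i * eval_e x i := by
    rw [← ps_sum k _ (fun i hi => by rw [eval_e_big x i hi, mul_zero])]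
    refine Finset.sum_congr rfl fun i _ => ?_
    rw [(hh_coeff τ i).2, cc_map, map_mul]
  rw [hS0] at j0
  rw [hS1] at j1
  have htr : (G * N).trace = -(PowerSeries.X * PowerSeries.mk fun m => (A ^ m * B).trace) := by
    have : G * N = - (z • (G * B.map Cz)) := by
      simp only [N, mul_neg, Matrix.mul_smul]
    rw [this, Matrix.trace_neg, Matrix.trace_smul, smul_eq_mul]
    congr 2
    ext n
    simp [Matrix.trace, Matrix.mul_apply, G, Cz, PowerSeries.coeff_mul_C]
  rw [← j0, htr] at j1
  simp only [Polynomial.coeff_one_zero] at j1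
  rw [Polynomial.coeff_one] at j1
  simp only [one_ne_zero, if_false, zero_sub, mul_neg, neg_inj] at j1
  exact j1.symm

theorem XCyc_eq_trace (m k : ℕ) :
    XCyc ℤ (m + 1) k = ((trMat (Polynomial.X) 1
      (fun j : Fin k => (Polynomial.C (MvPolynomial.X j : MvPolynomial (Fin k) ℤ)))) ^ m *
      trMat 1 (Polynomial.X)
      (fun j : Fin k => (Polynomial.C (MvPolynomial.X j : MvPolynomial (Fin k) ℤ)))).trace := by
  set x := (fun j : Fin k => (Polynomial.C (MvPolynomial.X j : MvPolynomial (Fin k) ℤ)))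
  have h := walk_sum (trMat Polynomial.X 1 x) m (fun i j => trMat 1 Polynomial.X x j i)
  have h2 : ((trMat Polynomial.X 1 x) ^ m * trMat 1 (Polynomial.X) x).trace =
      ∑ i, ∑ j, ((trMat Polynomial.X 1 x) ^ m) i j * trMat 1 Polynomial.X x j i := by
    simp [Matrix.trace, Matrix.mul_apply]
  rw [h2, ← h, XCyc, Finset.sum_filter]
  refine Finset.sum_congr rfl fun w _ => ?_
  have hlast : (⟨m + 1 - 1, Nat.sub_lt (Nat.succ_pos m) Nat.one_pos⟩ : Fin (m + 1)) = Fin.last m :=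
    rfl
  have hxw : Polynomial.C (xw ℤ w) = (∏ l : Fin m, x (w l.castSucc)) * x (w (Fin.last m)) := by
    rw [xw, Fin.prod_univ_castSucc, map_mul, map_prod]
  have hS : IsSmirnov w ↔ ∀ l : Fin m, w l.succ ≠ w l.castSucc := by
    constructor
    · intro h l
      exact h l.castSucc (by simp)
    · intro h i hi
      exact h ⟨i, by omega⟩
  have hne : FirstNeLast w ↔ w 0 ≠ w (Fin.last m) := by
    constructor
    · rintro ⟨_, h⟩; exact h
    · intro h; exact ⟨Nat.succ_pos m, h⟩
  have hgt : FirstGtLast w ↔ w (Fin.last m) < w 0 := by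
    constructor
    · rintro ⟨_, h⟩; exact h
    · intro h; exact ⟨Nat.succ_pos m, h⟩
  have hd : desc w = (Finset.univ.filter fun l : Fin m => w l.succ < w l.castSucc).card := by
    rw [desc]
    symm
    refine Finset.card_bij (fun l _ => l.castSucc) ?_ ?_ ?_
    · intro l hl
      rw [Finset.mem_filter] at hl ⊢
      exact ⟨Finset.mem_univ _, by simp, hl.2⟩
    · intro a _ b _ hab
      exact Fin.castSucc_injective _ hab
    · intro b hb
      rw [Finset.mem_filter] at hb
      obtain ⟨_, h1, h2⟩ := hb
      exact ⟨⟨b, by omega⟩, by rw [Finset.mem_filter]; exact ⟨Finset.mem_univ _, h2⟩, rfl⟩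
  have hprod : ∏ l : Fin m, trMat Polynomial.X 1 x (w l.castSucc) (w l.succ) =
      (∏ l : Fin m, x (w l.castSucc)) *
        (if IsSmirnov w then Polynomial.X ^ desc w else 0) := by
    simp only [trMat, Matrix.of_apply]
    rw [Finset.prod_mul_distrib]
    congr 1
    split_ifs with hs
    · rw [hS] at hs
      rw [hd, ← Finset.prod_const, Finset.prod_filter]
      refine Finset.prod_congr rfl fun l _ => ?_
      by_cases h1 : w l.succ < w l.castSucc
      · simp [h1]
      · have : w l.castSucc < w l.succ := lt_of_le_of_ne (not_lt.1 h1) (hs l).symm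
        simp [h1, this]
    · rw [hS] at hs
      push Not at hs
      obtain ⟨l, hl⟩ := hs
      exact Finset.prod_eq_zero (Finset.mem_univ l) (by simp [hl])
  rw [hprod, ProperCyc, descCyc, hxw]
  simp only [trMat, Matrix.of_apply]
  by_cases hs : IsSmirnov w
  · rcases lt_trichotomy (w 0) (w (Fin.last m)) with h1 | h1 | h1
    · simp [hs, hne, hgt, h1, h1.ne, h1.not_gt]; ring
    · simp [hs, hne, h1]
    · simp [hs, hne, hgt, h1, h1.ne', h1.not_gt]; ring
  · simp [hs]

theorem XCyc_zero (k : ℕ) : XCyc ℤ 0 k = 0 := by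
  rw [XCyc]
  refine Finset.sum_eq_zero fun w hw => ?_
  obtain ⟨_, _, h, _⟩ := Finset.mem_filter.1 hw
  exact absurd h (lt_irrefl 0)

theorem XCyc_rec (n k : ℕ) :
    XCyc ℤ n k = cc Polynomial.X n * Polynomial.C (esymm (Fin k) ℤ n) +
      ∑ p ∈ Finset.HasAntidiagonal.antidiagonal n, hh Polynomial.X 1 p.1 * Polynomial.C (esymm (Fin k) ℤ p.1) *
        XCyc ℤ p.2 k := by
  have h := gen_identity (Polynomial.X : Polynomial (MvPolynomial (Fin k) ℤ))
    (by
      intro h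
      have := congrArg (fun p => Polynomial.coeff p 0) h
      simp at this)
    (fun j : Fin k => (Polynomial.C (MvPolynomial.X j : MvPolynomial (Fin k) ℤ)))
  simp only [← XCyc_eq_trace, eval_e_esymm] at h
  have h3 : (PowerSeries.X * PowerSeries.mk fun m => XCyc ℤ (m + 1) k) =
      PowerSeries.mk fun m => XCyc ℤ m k := by
    ext1 n
    rcases n with _ | n
    · simp [XCyc_zero]
    · simp [PowerSeries.coeff_succ_X_mul]
  rw [h3, sub_mul, one_mul] at h
  have h4 := congrArg (PowerSeries.coeff n) h
  rw [map_sub, PowerSeries.coeff_mul] at h4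
  simp only [PowerSeries.coeff_mk] at h4
  rw [← h4]; ring

def br {R : Type} [CommRing R] (p : ℕ) : Polynomial R := ∑ j ∈ Finset.range p, Polynomial.X ^ j

theorem br_succ {R : Type} [CommRing R] (p : ℕ) :
    (br (p + 1) : Polynomial R) = br p + Polynomial.X ^ p := Finset.sum_range_succ _ _

theorem br_zero {R : Type} [CommRing R] : (br 0 : Polynomial R) = 0 := Finset.sum_range_zero _

theorem br_add {R : Type} [CommRing R] (p q : ℕ) :
    (br (p + q) : Polynomial R) = br p + Polynomial.X ^ p * br q := by
  induction q with
  | zero => simp [br_zero]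
  | succ q ih => rw [← add_assoc, br_succ, ih, br_succ]; ring

theorem br_one {R : Type} [CommRing R] : (br 1 : Polynomial R) = 1 := by simp [br]

theorem br_mul {R : Type} [CommRing R] (p q : ℕ) :
    (br (p + 1) * br (q + 1) : Polynomial R) = br (p + q + 1) + Polynomial.X * (br p * br q) := by
  have h1 : (br (p + 1) : Polynomial R) = 1 + Polynomial.X * br p := by
    rw [add_comm p 1, br_add, br_one, pow_one]
  have h2 : (br (p + q + 1) : Polynomial R) = br (q + 1) + Polynomial.X ^ (q + 1) * br p := by
    rw [show p + q + 1 = (q + 1) + p by ring, br_add]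
  rw [h2, h1, br_succ q]; ring

theorem hh_br {R : Type} [CommRing R] (i : ℕ) :
    hh (Polynomial.X : Polynomial R) 1 i = Polynomial.X * br (i - 1) := by
  rw [hh, br, Finset.sum_Ico_eq_sum_range, Finset.mul_sum]
  exact Finset.sum_congr rfl fun j _ => by rw [one_pow]; ring

theorem cc_succ {R : Type} [CommRing R] (i : ℕ) :
    cc (Polynomial.X : Polynomial R) (i + 2) = cc Polynomial.X (i + 1) +
      ((i + 1 : ℕ) : Polynomial R) * Polynomial.X ^ i + Polynomial.X ^ (i + 2) +
      Polynomial.X ^ 2 * br i := by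
  rw [cc, Finset.sum_Ico_succ_top (by omega)]
  have h : Polynomial.X ^ 2 * (br i : Polynomial R) =
      ∑ j ∈ Finset.Ico 1 (i + 1), Polynomial.X ^ (j + 1) := by
    rw [br, Finset.sum_Ico_eq_sum_range, Finset.mul_sum]
    exact Finset.sum_congr rfl fun j _ => by ring
  have h2 : ∑ j ∈ Finset.Ico 1 (i + 1), ((j : Polynomial R) * Polynomial.X ^ (j - 1) +
      ((i + 1 + 1 - j : ℕ) : Polynomial R) * Polynomial.X ^ (j + 1)) =
      cc Polynomial.X (i + 1) + Polynomial.X ^ 2 * br i := by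
    rw [h, cc, ← Finset.sum_add_distrib]
    refine Finset.sum_congr rfl fun j hj => ?_
    have hj' := Finset.mem_Ico.1 hj
    rw [show i + 1 + 1 - j = (i + 1 - j) + 1 by omega]
    push_cast
    ring
  rw [h2, show i + 1 + 1 - (i + 1) = 1 by omega]
  simp only [Nat.add_sub_cancel]
  push_cast
  ring

theorem cc_br {R : Type} [CommRing R] (q : ℕ) :
    cc (Polynomial.X : Polynomial R) (q + 3) = br (q + 4) + Polynomial.X * br (q + 2) +
      ((q + 3 : ℕ) : Polynomial R) * (Polynomial.X ^ 2 * br q) := by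
  induction q with
  | zero => simp [cc, br, Finset.sum_Ico_succ_top, Finset.sum_range_succ]; ring
  | succ q ih =>
    rw [show q + 1 + 3 = (q + 2) + 2 by ring, cc_succ, show q + 2 + 1 = q + 3 by ring, ih,
      show q + 1 + 4 = (q + 4) + 1 by ring, br_succ (q + 4), show q + 1 + 2 = (q + 2) + 1 by ring,
      br_succ (q + 2), br_succ (q + 1), br_succ q]
    push_cast
    ring

abbrev TP (k : ℕ) := Polynomial (MvPolynomial (Fin k) ℤ)

def emu (k : ℕ) (μ : Multiset ℕ) : MvPolynomial (Fin k) ℤ := (μ.map (esymm (Fin k) ℤ)).prod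

def Good (k n : ℕ) : AddSubmonoid (TP k) :=
  AddSubmonoid.closure {P | ∃ (a p : ℕ) (μ : Multiset ℕ), 2 * a + p = n + 1 ∧ (∀ i ∈ μ, 0 < i) ∧
    P = Polynomial.X ^ a * br p * Polynomial.C (emu k μ)}

theorem good_gen {k n a p : ℕ} {μ : Multiset ℕ} (h : 2 * a + p = n + 1) (hμ : ∀ i ∈ μ, 0 < i) :
    Polynomial.X ^ a * br p * Polynomial.C (emu k μ) ∈ Good k n :=
  AddSubmonoid.subset_closure ⟨a, p, μ, h, hμ, rfl⟩

theorem good_gen_mul {k n : ℕ} {μ : Multiset ℕ} (hμ : ∀ i ∈ μ, 0 < i) (p : ℕ) :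
    ∀ q a : ℕ, 2 * a + p + q = n + 2 →
      Polynomial.X ^ a * (br p * br q) * Polynomial.C (emu k μ) ∈ Good k n := by
  induction p with
  | zero => intro q a _; simp [br_zero, zero_mem]
  | succ p ih =>
    intro q a h
    rcases q with _ | q
    · simp [br_zero, zero_mem]
    · have h1 := good_gen (k := k) (n := n) (a := a) (p := p + q + 1) (by omega) hμ
      have h2 := ih q (a + 1) (by omega)
      convert add_mem h1 h2 using 1
      rw [br_mul]; ring

theorem good_mul {k n i : ℕ} (hi : 2 ≤ i) {P : TP k} (hP : P ∈ Good k n) :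
    hh Polynomial.X 1 i * Polynomial.C (esymm (Fin k) ℤ i) * P ∈ Good k (i + n) := by
  induction hP using AddSubmonoid.closure_induction with
  | mem P hP =>
    obtain ⟨a, p, μ, h, hμ, rfl⟩ := hP
    have := good_gen_mul (k := k) (n := i + n) (μ := i ::ₘ μ)
      (by
        intro j hj
        rcases Multiset.mem_cons.1 hj with rfl | hj
        · omega
        · exact hμ j hj) p (i - 1) (a + 1) (by omega)
    convert this using 1
    simp only [emu, Multiset.map_cons, Multiset.prod_cons, hh_br, map_mul]
    ring
  | zero => simp [zero_mem]
  | add x y _ _ hx hy => rw [mul_add]; exact add_mem hx hy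

def bad (k : ℕ) : ℕ → TP k
  | 0 => 0
  | 1 => 0
  | 2 => (1 + Polynomial.X ^ 2) * Polynomial.C (esymm (Fin k) ℤ 2)
  | (n + 3) => hh Polynomial.X 1 2 * Polynomial.C (esymm (Fin k) ℤ 2) * bad k (n + 1)

theorem bad_even (k j : ℕ) : bad k (2 * j + 2) =
    Polynomial.X ^ j * (1 + Polynomial.X ^ 2) * Polynomial.C (esymm (Fin k) ℤ 2 ^ (j + 1)) := by
  induction j with
  | zero => simp [bad]
  | succ j ih =>
    rw [show 2 * (j + 1) + 2 = (2 * j + 1) + 3 by ring, bad, show 2 * j + 1 + 1 = 2 * j + 2 by ring,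
      ih, hh_br, show 2 - 1 = 1 from rfl, br_one, pow_succ _ (j + 1), map_mul]
    ring

theorem bad_odd (k j : ℕ) : bad k (2 * j + 1) = 0 := by
  induction j with
  | zero => simp [bad]
  | succ j ih =>
    rcases j with _ | j
    · simp [bad]
    · rw [show 2 * (j + 1 + 1) + 1 = (2 * j + 2) + 3 by ring, bad,
        show 2 * j + 2 + 1 = 2 * (j + 1) + 1 by ring, ih, mul_zero]

theorem bad_mul {k m i : ℕ} (hi : 3 ≤ i) :
    hh Polynomial.X 1 i * Polynomial.C (esymm (Fin k) ℤ i) * bad k m ∈ Good k (i + m) := by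
  rcases Nat.even_or_odd' m with ⟨j, rfl | rfl⟩
  · rcases j with _ | j
    · simp [bad, zero_mem]
    · obtain ⟨q, rfl⟩ := Nat.exists_eq_add_of_le hi
      have hμ : ∀ l ∈ ((3 + q) ::ₘ Multiset.replicate (j + 1) 2), 0 < l := by
        intro l hl
        rcases Multiset.mem_cons.1 hl with rfl | hl
        · omega
        · rw [Multiset.eq_of_mem_replicate hl]; omega
      have h1 := good_gen (k := k) (n := 3 + q + 2 * (j + 1)) (a := j + 1) (p := q + 2 + 2)
        (by omega) hμ
      have h2 := good_gen (k := k) (n := 3 + q + 2 * (j + 1)) (a := j + 3) (p := q)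
        (by omega) hμ
      convert add_mem h1 h2 using 1
      rw [show 2 * (j + 1) = 2 * j + 2 by ring, bad_even, hh_br, show 3 + q - 1 = q + 2 by omega]
      simp only [emu, Multiset.map_cons, Multiset.prod_cons, Multiset.map_replicate,
        Multiset.prod_replicate, map_mul, br_succ]
      ring
  · rw [bad_odd, mul_zero]; exact zero_mem _

theorem XCyc_good (k n : ℕ) : ∃ Q ∈ Good k n, XCyc ℤ n k = Q + bad k n := by
  induction n using Nat.strong_induction_on with
  | _ n ih =>
    rcases n with _ | _ | _ | q
    · exact ⟨0, zero_mem _, by simp [XCyc_zero, bad]⟩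
    · refine ⟨0, zero_mem _, ?_⟩
      rw [XCyc_rec]
      simp [cc, bad, hh_br, Finset.Nat.antidiagonal_succ, br_zero]
    · refine ⟨0, zero_mem _, ?_⟩
      rw [XCyc_rec]
      simp [cc, bad, hh_br, Finset.Nat.antidiagonal_succ, br_zero, XCyc_zero]
    · have hs : ∀ p ∈ Finset.HasAntidiagonal.antidiagonal (q + 3),
          ∃ Q ∈ Good k (q + 3), hh Polynomial.X 1 p.1 * Polynomial.C (esymm (Fin k) ℤ p.1) *
            XCyc ℤ p.2 k = Q + if p = (2, q + 1) then bad k (q + 3) else 0 := by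
        rintro ⟨i, m⟩ hp
        have hp : i + m = q + 3 := by simpa using hp
        by_cases h2 : i < 2
        · refine ⟨0, zero_mem _, ?_⟩
          have : i - 1 = 0 := by omega
          have h3 : i ≠ 2 := by omega
          simp [hh_br, this, br_zero, h3]
        · obtain ⟨Q, hQ, hX⟩ := ih m (by omega)
          have hg := good_mul (i := i) (by omega) hQ
          rw [hp] at hg
          by_cases h3 : i = 2
          · subst h3
            obtain rfl : m = q + 1 := by omega
            refine ⟨_, hg, ?_⟩
            simp only [if_true, hX, bad]
            ring
          · have hb := bad_mul (k := k) (m := m) (i := i) (by omega)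
            rw [hp] at hb
            refine ⟨_, add_mem hg hb, ?_⟩
            simp only [Prod.mk.injEq, h3, false_and, if_false, hX]
            ring
      choose! Q hQ hE using hs
      have hc : cc Polynomial.X (q + 3) * Polynomial.C (esymm (Fin k) ℤ (q + 3)) ∈
          Good k (q + 3) := by
        have hμ : ∀ l ∈ ({q + 3} : Multiset ℕ), 0 < l := by
          intro l hl
          rw [Multiset.mem_singleton.1 hl]; omega
        have h1 := good_gen (k := k) (n := q + 3) (a := 0) (p := q + 4) (by omega) hμ
        have h2 := good_gen (k := k) (n := q + 3) (a := 1) (p := q + 2) (by omega) hμ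
        have h3 := good_gen (k := k) (n := q + 3) (a := 2) (p := q) (by omega) hμ
        convert add_mem (add_mem h1 h2) (nsmul_mem h3 (q + 3)) using 1
        rw [cc_br, nsmul_eq_mul]
        simp only [emu, Multiset.map_singleton, Multiset.prod_singleton]
        ring
      refine ⟨_, add_mem hc (sum_mem hQ), ?_⟩
      rw [XCyc_rec, Finset.sum_congr rfl hE, Finset.sum_add_distrib, Finset.sum_ite_eq',
        if_pos (by simp; ring), ← add_assoc]

theorem epos_zero (k : ℕ) : EPosX ℤ (0 : MvPolynomial (Fin k) ℤ) :=
  ⟨∅, 0, by simp, by simp, by simp⟩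

theorem epos_emu (k : ℕ) {μ : Multiset ℕ} (hμ : ∀ i ∈ μ, 0 < i) : EPosX ℤ (emu k μ) :=
  ⟨{μ}, 1, by simpa using hμ, by simp, by simp [emu]⟩

theorem epos_add {k : ℕ} {P Q : MvPolynomial (Fin k) ℤ} (hP : EPosX ℤ P) (hQ : EPosX ℤ Q) :
    EPosX ℤ (P + Q) := by
  obtain ⟨S, c, h1, h2, rfl⟩ := hP
  obtain ⟨S', c', h1', h2', rfl⟩ := hQ
  refine ⟨S ∪ S', fun μ => (if μ ∈ S then c μ else 0) + (if μ ∈ S' then c' μ else 0), ?_, ?_, ?_⟩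
  · intro μ hμ
    rcases Finset.mem_union.1 hμ with h | h
    · exact h1 μ h
    · exact h1' μ h
  · intro μ _
    refine add_nonneg ?_ ?_
    · split_ifs with h
      · exact h2 μ h
      · exact le_rfl
    · split_ifs with h
      · exact h2' μ h
      · exact le_rfl
  · simp only [map_add, add_mul, Finset.sum_add_distrib]
    congr 1
    · rw [← Finset.sum_subset (Finset.subset_union_left (s₁ := S) (s₂ := S'))]
      · exact Finset.sum_congr rfl fun μ h => by rw [if_pos h]
      · intro μ _ h
        rw [if_neg h]; simp
    · rw [← Finset.sum_subset (Finset.subset_union_right (s₁ := S) (s₂ := S'))]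
      · exact Finset.sum_congr rfl fun μ h => by rw [if_pos h]
      · intro μ _ h
        rw [if_neg h]; simp

theorem coeff_gen {k : ℕ} (a p j : ℕ) (e : MvPolynomial (Fin k) ℤ) :
    (Polynomial.X ^ a * br p * Polynomial.C e).coeff j = if a ≤ j ∧ j < a + p then e else 0 := by
  rw [Polynomial.coeff_mul_C, Polynomial.coeff_X_pow_mul', br, Polynomial.finsetSum_coeff]
  simp only [Polynomial.coeff_X_pow, Finset.sum_ite_eq, Finset.mem_range]
  by_cases h1 : a ≤ j
  · by_cases h2 : j < a + p
    · have : j - a < p := by omega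
      simp [h1, h2, this]
    · have : ¬ j - a < p := by omega
      simp [h2, this]
  · simp [h1]

theorem palin_add {R : Type} [CommRing R] {A B : Polynomial R} {m : ℤ} (hA : PalinZ A m)
    (hB : PalinZ B m) : PalinZ (A + B) m := by
  intro j
  rw [Polynomial.coeff_add, hA j, hB j]
  split_ifs <;> simp

theorem palin_sub {R : Type} [CommRing R] {A B : Polynomial R} {m : ℤ} (hA : PalinZ A m)
    (hB : PalinZ B m) : PalinZ (A - B) m := by
  intro j
  rw [Polynomial.coeff_sub, hA j, hB j]
  split_ifs <;> simp

theorem good_palin {k n : ℕ} {P : TP k} (hP : P ∈ Good k n) : PalinZ P (n : ℤ) := by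
  induction hP using AddSubmonoid.closure_induction with
  | mem P hP =>
    obtain ⟨a, p, μ, h, hμ, rfl⟩ := hP
    intro j
    rw [coeff_gen, coeff_gen]
    by_cases hj : (j : ℤ) ≤ n
    · rw [if_pos hj]
      have : (a ≤ j ∧ j < a + p) ↔ (a ≤ ((n : ℤ) - j).toNat ∧ ((n : ℤ) - j).toNat < a + p) := by
        omega
      simp only [this]
    · rw [if_neg hj, if_neg (by omega)]
  | zero => intro j; simp
  | add x y _ _ hx hy => exact palin_add hx hy

theorem good_unimodal {k n : ℕ} {P : TP k} (hP : P ∈ Good k n) :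
    EPosX ℤ (P.coeff 0) ∧ (∀ j < n / 2, EPosX ℤ (P.coeff (j + 1) - P.coeff j)) ∧
    (∀ j, n / 2 ≤ j → EPosX ℤ (P.coeff j - P.coeff (j + 1))) := by
  induction hP using AddSubmonoid.closure_induction with
  | mem P hP =>
    obtain ⟨a, p, μ, h, hμ, rfl⟩ := hP
    have hz := epos_zero k
    have he := epos_emu k hμ
    refine ⟨?_, ?_, ?_⟩
    · rw [coeff_gen]
      split_ifs <;> assumption
    · intro j hj
      rw [coeff_gen, coeff_gen]
      split_ifs
      · simpa using hz
      · simpa using he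
      · omega
      · simpa using hz
    · intro j hj
      rw [coeff_gen, coeff_gen]
      split_ifs
      · simpa using hz
      · simpa using he
      · omega
      · simpa using hz
  | zero => simp [epos_zero]
  | add x y _ _ hx hy =>
    refine ⟨?_, ?_, ?_⟩
    · rw [Polynomial.coeff_add]; exact epos_add hx.1 hy.1
    · intro j hj
      rw [Polynomial.coeff_add, Polynomial.coeff_add, add_sub_add_comm]
      exact epos_add (hx.2.1 j hj) (hy.2.1 j hj)
    · intro j hj
      rw [Polynomial.coeff_add, Polynomial.coeff_add, add_sub_add_comm]
      exact epos_add (hx.2.2 j hj) (hy.2.2 j hj)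

/-- For even `n ≥ 2`, `X_{C_n}(x,t) + t^{n/2} e_2(x)^{n/2}` is e-unimodal
and palindromic with center of symmetry `n/2`; in particular `X_{C_n}(x,t)` is palindromic
with center of symmetry `n/2`. -/
theorem chromatic_cycle_even_eUnimodal (n k : ℕ) (heven : Even n) (hn : 2 ≤ n) (hk : 1 ≤ k) :
    (EUnimodal ℤ (XCyc ℤ n k +
        Polynomial.X ^ (n / 2) * Polynomial.C (esymm (Fin k) ℤ 2 ^ (n / 2))) ∧
      PalinZ (XCyc ℤ n k +
        Polynomial.X ^ (n / 2) * Polynomial.C (esymm (Fin k) ℤ 2 ^ (n / 2))) (n : ℤ)) ∧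
    PalinZ (XCyc ℤ n k) (n : ℤ) := by
  obtain ⟨m, rfl⟩ : ∃ m, n = 2 * m + 2 := by
    obtain ⟨r, hr⟩ := heven
    exact ⟨r - 1, by omega⟩
  obtain ⟨Q, hQ, hX⟩ := XCyc_good k (2 * m + 2)
  have hm : (2 * m + 2) / 2 = m + 1 := by omega
  have hμ : ∀ l ∈ Multiset.replicate (m + 1) 2, 0 < l := by
    intro l hl
    rw [Multiset.eq_of_mem_replicate hl]; omega
  have he : emu k (Multiset.replicate (m + 1) 2) = esymm (Fin k) ℤ 2 ^ (m + 1) := by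
    simp only [emu, Multiset.map_replicate, Multiset.prod_replicate]
  have hmono : Polynomial.X ^ (m + 1) * Polynomial.C (esymm (Fin k) ℤ 2 ^ (m + 1)) ∈
      Good k (2 * m + 2) := by
    have h1 := good_gen (k := k) (n := 2 * m + 2) (a := m + 1) (p := 1) (by omega) hμ
    rwa [he, br_one, mul_one] at h1
  have hgood : XCyc ℤ (2 * m + 2) k +
      Polynomial.X ^ (m + 1) * Polynomial.C (esymm (Fin k) ℤ 2 ^ (m + 1)) ∈
      Good k (2 * m + 2) := by
    have h1 := good_gen (k := k) (n := 2 * m + 2) (a := m) (p := 3) (by omega) hμ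
    rw [he] at h1
    convert add_mem hQ h1 using 1
    rw [hX, bad_even]
    simp only [br_succ, br_zero]
    ring
  rw [hm]
  obtain ⟨u0, u1, u2⟩ := good_unimodal hgood
  refine ⟨⟨⟨u0, _, u1, u2⟩, good_palin hgood⟩, ?_⟩
  have := palin_sub (good_palin hgood) (good_palin hmono)
  rwa [add_sub_cancel_right] at this

end
end
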